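/- arXiv:1711.04544 — 2 statements merged into one kernel-verified Lean document; each statement's English description precedes it below -/
import Mathlib

section
/- Let P be a real polynomial of degree d on ℝ^n such that the zero set Z(P) := P^{-1}(0) has Hausdorff dimension k < n − 1. Assume: (a) for each 1 ≤ i ≤ n, P is a monic polynomial of degree d in the variable x_i (the coefficient of x_i^d in P equals 1); (b) the collection (Z_1, …, Z_n) is separated at infinity, where Z_i := {x ∈ ℝ^n : ∂P/∂x_i(x) = 0}. Let Z' := Z_1 ∩ ⋯ ∩ Z_n and let k' be the Hausdorff dimension of Z'. Then there exist positive constants ν, C and δ_1, all independent of r and δ, such that for every r > 0 and every 0 < δ < δ_1, vol_n(V_δ ∩ Δ_r^n) ≤ C·r^{k'}·δ^ν. -/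
open MeasureTheory Metric MvPolynomial Filter
open scoped ENNReal NNReal

/-- The open cube `Δ_r^n = (-r, r)^n` in `ℝ^n`. -/
def cube (n : ℕ) (r : ℝ) : Set (EuclideanSpace ℝ (Fin n)) :=
  {x | ∀ i, x i ∈ Set.Ioo (-r) r}

/-- The sublevel set `V_δ = {x ∈ ℝ^n : |P(x)| ≤ δ}`. -/
def sublevel {n : ℕ} (P : MvPolynomial (Fin n) ℝ) (δ : ℝ) :
    Set (EuclideanSpace ℝ (Fin n)) :=
  {x | |eval (fun i => x i) P| ≤ δ}

/-- A collection `S_1, …, S_k` of (closed) subsets of `ℝ^n` is *separated at infinity* if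
`S := S_1 ∩ ⋯ ∩ S_k ≠ ∅` and for all sequences `a_{j,l} ∈ S_j` with `‖a_{j,l}‖ → ∞` and
`‖a_{j,l} - a_{m,l}‖ → 0` for all `j < m`, one has `d(a_{j,l}, S) → 0` for each `j`. -/
def SeparatedAtInfinity {n k : ℕ} (S : Fin k → Set (EuclideanSpace ℝ (Fin n))) : Prop :=
  (⋂ j, S j).Nonempty ∧
  ∀ a : Fin k → ℕ → EuclideanSpace ℝ (Fin n),
    (∀ j l, a j l ∈ S j) →
    (∀ j, Tendsto (fun l => ‖a j l‖) atTop atTop) →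
    (∀ j m : Fin k, j < m → Tendsto (fun l => ‖a j l - a m l‖) atTop (nhds 0)) →
    ∀ j, Tendsto (fun l => infDist (a j l) (⋂ i, S i)) atTop (nhds 0)



/-- restriction of `P` to the line through `x` in direction `i` -/
noncomputable def slicePoly {n : ℕ} (P : MvPolynomial (Fin n) ℝ) (i : Fin n) (x : Fin n → ℝ) :
    Polynomial ℝ :=
  MvPolynomial.aeval (fun j => if j = i then Polynomial.X else Polynomial.C (x j)) P

lemma slicePoly_eval {n : ℕ} (P : MvPolynomial (Fin n) ℝ) (i : Fin n) (x : Fin n → ℝ) (t : ℝ) :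
    (slicePoly P i x).eval t = eval (Function.update x i t) P := by
  unfold slicePoly
  induction P using MvPolynomial.induction_on with
  | C a => simp
  | add p q hp hq => simp [hp, hq]
  | mul_X p j hp =>
    simp only [map_mul, aeval_X, Polynomial.eval_mul, hp, eval_X]
    by_cases h : j = i
    · subst h; simp
    · simp [h]

lemma slicePoly_derivative {n : ℕ} (P : MvPolynomial (Fin n) ℝ) (i : Fin n) (x : Fin n → ℝ) :
    Polynomial.derivative (slicePoly P i x) = slicePoly (pderiv i P) i x := by
  unfold slicePoly
  induction P using MvPolynomial.induction_on with
  | C a => simp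
  | add p q hp hq => simp [hp, hq]
  | mul_X p j hp =>
    simp only [map_mul, aeval_X, Polynomial.derivative_mul, hp, Derivation.leibniz, pderiv_X,
      smul_eq_mul, map_add]
    by_cases h : j = i
    · subst h; simp; ring
    · simp [h]; ring

lemma slicePoly_eq_sum {n : ℕ} (P : MvPolynomial (Fin n) ℝ) (i : Fin n) (x : Fin n → ℝ) :
    slicePoly P i x = ∑ m ∈ P.support, Polynomial.monomial (m i)
      (coeff m P * ∏ j ∈ Finset.univ.erase i, x j ^ m j) := by
  unfold slicePoly
  rw [aeval_def, eval₂_eq']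
  refine Finset.sum_congr rfl fun m _ => ?_
  rw [← Finset.mul_prod_erase _ _ (Finset.mem_univ i)]
  rw [Finset.prod_congr rfl (g := fun j => Polynomial.C (x j ^ m j))]
  · rw [← map_prod]
    simp only [if_true, Polynomial.algebraMap_eq]
    rw [← Polynomial.C_mul_X_pow_eq_monomial, Polynomial.C_mul]; ring
  · intro j hj
    simp [Finset.ne_of_mem_erase hj]

lemma slicePoly_natDegree_le {n : ℕ} (P : MvPolynomial (Fin n) ℝ) (i : Fin n) (x : Fin n → ℝ)
    (d : ℕ) (hd : P.totalDegree ≤ d) : (slicePoly P i x).natDegree ≤ d := by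
  rw [slicePoly_eq_sum]
  refine Polynomial.natDegree_sum_le_of_forall_le _ _ fun m hm => ?_
  refine (Polynomial.natDegree_monomial_le _).trans (le_trans ?_ hd)
  refine le_trans ?_ (le_totalDegree hm)
  exact Finsupp.le_degree i m 

lemma slicePoly_coeff {n : ℕ} (P : MvPolynomial (Fin n) ℝ) (i : Fin n) (x : Fin n → ℝ)
    (d : ℕ) (hd : P.totalDegree ≤ d) :
    (slicePoly P i x).coeff d = coeff (Finsupp.single i d) P := by
  rw [slicePoly_eq_sum, Polynomial.finsetSum_coeff]
  rw [Finset.sum_eq_single (Finsupp.single i d)]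
  · simp only [Finsupp.single_eq_same, Polynomial.coeff_monomial, if_true]
    rw [Finset.prod_eq_one, mul_one]
    intro j hj
    simp [Finsupp.single_eq_of_ne (Finset.ne_of_mem_erase hj)]
  · intro m hm hne
    rw [Polynomial.coeff_monomial, if_neg]
    intro hmi
    apply hne
    have h1 : m.degree ≤ d := (le_totalDegree hm).trans hd
    rw [Finsupp.degree_eq_sum, ← Finset.add_sum_erase _ _ (Finset.mem_univ i), hmi] at h1
    have h2 : ∑ j ∈ Finset.univ.erase i, m j = 0 := by omega
    rw [Finset.sum_eq_zero_iff] at h2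
    ext j
    by_cases h : j = i
    · subst h; simp [hmi]
    · rw [Finsupp.single_eq_of_ne h]; exact h2 j (by simp [h])
  · intro h
    simp only [Finsupp.single_eq_same, notMem_support_iff.mp h]
    simp

lemma poly_sublevel_subset (p : Polynomial ℝ) (e : ℕ) (he : 1 ≤ e) (hdeg : p.natDegree = e)
    (hlead : 1 ≤ |p.leadingCoeff|) (δ : ℝ) (hδ : 0 < δ) :
    ∃ T : Finset ℝ, T.card ≤ e ∧ ∀ t, |p.eval t| ≤ δ →
      ∃ c ∈ T, |t - c| ≤ δ ^ (1 / (e : ℝ)) := by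
  classical
  let q := p.map (algebraMap ℝ ℂ)
  have hp0 : p ≠ 0 := by rintro rfl; simp at hdeg; omega
  have hcard : q.roots.card = e := by
    rw [← hdeg, ← Polynomial.natDegree_map (algebraMap ℝ ℂ) (p := p)]
    exact IsAlgClosed.card_roots_eq_natDegree
  refine ⟨(q.roots.map Complex.re).toFinset, ?_, ?_⟩
  · refine (Multiset.toFinset_card_le _).trans ?_
    simp [hcard]
  · intro t ht
    by_contra! hcon
    have hfac := (IsAlgClosed.splits q).eq_prod_roots
    have hev : q.eval (t : ℂ) = ((p.eval t : ℝ) : ℂ) := by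
      simp only [q]
      rw [Polynomial.eval_map, ← Polynomial.aeval_def]
      exact Polynomial.aeval_algebraMap_apply_eq_algebraMap_eval t p
    rw [hfac] at hev
    have hn := congrArg norm hev
    rw [Complex.norm_real, Real.norm_eq_abs] at hn
    simp only [Polynomial.eval_mul, Polynomial.eval_C, norm_mul, Polynomial.eval_multiset_prod, Multiset.map_map] at hn
    have hl : ‖q.leadingCoeff‖ = |p.leadingCoeff| := by
      simp only [q]
      rw [Polynomial.leadingCoeff_map]; simp
    have key : ∀ s : Multiset ℂ, (∀ z ∈ s, δ ^ (1 / (e : ℝ)) < |t - z.re|) → s ≠ 0 →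
        (δ ^ (1 / (e : ℝ))) ^ s.card < ‖(s.map (fun z => (t : ℂ) - z)).prod‖ := by
      intro s
      induction s using Multiset.induction_on with
      | empty => simp
      | cons a s ih =>
        intro h _
        have h1 : δ ^ (1 / (e : ℝ)) < ‖(t : ℂ) - a‖ := by
          refine (h a (by simp)).trans_le ?_
          have := Complex.abs_re_le_norm ((t : ℂ) - a)
          simpa using this
        have h0 : 0 < δ ^ (1 / (e : ℝ)) := by positivity
        by_cases hs : s = 0
        · subst hs; simpa using h1
        · have := ih (fun z hz => h z (by simp [hz])) hs
          simp only [Multiset.card_cons, Multiset.map_cons, Multiset.prod_cons, norm_mul, pow_succ']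
          exact mul_lt_mul h1 this.le (by positivity) (by positivity)
    have hk := key q.roots (fun z hz => hcon z.re (by simp only [Multiset.mem_toFinset]; exact Multiset.mem_map_of_mem _ hz)) (by
      intro h; rw [h] at hcard; simp at hcard; omega)
    have hpow : (δ ^ (1 / (e : ℝ))) ^ e = δ := by
      rw [← Real.rpow_natCast, ← Real.rpow_mul hδ.le]
      rw [one_div_mul_cancel (by positivity), Real.rpow_one]
    rw [hcard, hpow] at hk
    have e2 : (Multiset.map ((Polynomial.eval (t:ℂ)) ∘ fun a => Polynomial.X - Polynomial.C a) q.roots)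
        = Multiset.map (fun z => (t : ℂ) - z) q.roots := by
      apply Multiset.map_congr rfl; intro z _; simp
    rw [e2, hl] at hn
    have : δ < |p.eval t| := by
      rw [← hn]
      calc δ < _ := hk
        _ = 1 * _ := (one_mul _).symm
        _ ≤ _ := by gcongr
    linarith

lemma poly_sublevel_volume (p : Polynomial ℝ) (e : ℕ) (he : 1 ≤ e) (hdeg : p.natDegree = e)
    (hlead : 1 ≤ |p.leadingCoeff|) (δ : ℝ) (hδ : 0 < δ) :
    volume {t : ℝ | |p.eval t| ≤ δ} ≤ ENNReal.ofReal (2 * e * δ ^ (1 / (e : ℝ))) := by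
  obtain ⟨T, hT, hcov⟩ := poly_sublevel_subset p e he hdeg hlead δ hδ
  calc volume {t : ℝ | |p.eval t| ≤ δ}
      ≤ volume (⋃ c ∈ T, Set.Icc (c - δ ^ (1 / (e : ℝ))) (c + δ ^ (1 / (e : ℝ)))) := by
        apply measure_mono
        intro t ht
        obtain ⟨c, hc, h⟩ := hcov t ht
        simp only [Set.mem_iUnion]
        refine ⟨c, hc, ?_⟩
        rw [abs_le] at h
        constructor <;> linarith
    _ ≤ ∑ c ∈ T, volume (Set.Icc (c - δ ^ (1 / (e : ℝ))) (c + δ ^ (1 / (e : ℝ)))) :=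
        measure_biUnion_finset_le _ _
    _ = T.card * ENNReal.ofReal (2 * δ ^ (1 / (e : ℝ))) := by
        simp only [Real.volume_Icc]
        rw [Finset.sum_congr rfl (g := fun _ => ENNReal.ofReal (2 * δ ^ (1 / (e : ℝ))))]
        · simp
        · intro c _; congr 1; ring
    _ ≤ e * ENNReal.ofReal (2 * δ ^ (1 / (e : ℝ))) := by gcongr
    _ = _ := by
        rw [← ENNReal.ofReal_natCast, ← ENNReal.ofReal_mul (by positivity)]
        congr 1; ring

lemma exists_critical (p : Polynomial ℝ) (hp : ∀ t, 0 ≤ p.eval t) (δ L x : ℝ)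
    (hvol : volume {t : ℝ | |p.eval t| ≤ δ} < ENNReal.ofReal L) (hx : p.eval x ≤ δ) :
    ∃ y, |y - x| ≤ L ∧ p.derivative.eval y = 0 := by
  have h1 : ∃ b ∈ Set.Icc x (x + L), δ < p.eval b := by
    by_contra! h
    have : ENNReal.ofReal L ≤ volume {t : ℝ | |p.eval t| ≤ δ} := by
      calc ENNReal.ofReal L = volume (Set.Icc x (x + L)) := by rw [Real.volume_Icc]; congr 1; ring
        _ ≤ _ := measure_mono fun t ht => by
          simp only [Set.mem_ofPred_eq, abs_of_nonneg (hp t)]; exact h t ht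
    exact absurd hvol (not_lt.mpr this)
  have h2 : ∃ a ∈ Set.Icc (x - L) x, δ < p.eval a := by
    by_contra! h
    have : ENNReal.ofReal L ≤ volume {t : ℝ | |p.eval t| ≤ δ} := by
      calc ENNReal.ofReal L = volume (Set.Icc (x - L) x) := by rw [Real.volume_Icc]; congr 1; ring
        _ ≤ _ := measure_mono fun t ht => by
          simp only [Set.mem_ofPred_eq, abs_of_nonneg (hp t)]; exact h t ht
    exact absurd hvol (not_lt.mpr this)
  obtain ⟨b, ⟨hb1, hb2⟩, hb⟩ := h1
  obtain ⟨a, ⟨ha1, ha2⟩, ha⟩ := h2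
  obtain ⟨y, hy, hmin⟩ := (isCompact_Icc (a := a) (b := b)).exists_isMinOn ⟨x, ha2, hb1⟩
    p.continuous.continuousOn
  have hyx : p.eval y ≤ p.eval x := hmin (show x ∈ Set.Icc a b from ⟨ha2, hb1⟩)
  have hya : a < y := lt_of_le_of_ne hy.1 (by rintro rfl; linarith)
  have hyb : y < b := lt_of_le_of_ne hy.2 (by rintro rfl; linarith)
  refine ⟨y, by rw [abs_le]; constructor <;> linarith, ?_⟩
  have hloc : IsLocalMin (fun t => p.eval t) y := hmin.isLocalMin (Icc_mem_nhds hya hyb)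
  have := hloc.deriv_eq_zero
  rwa [Polynomial.deriv] at this

/-- Sublevel estimate in a box. -/
lemma box_sublevel_volume {m : ℕ} (Q : MvPolynomial (Fin (m+1)) ℝ) (e : ℕ) (he : 1 ≤ e)
    (hdeg : Q.totalDegree ≤ e) (hco : 1 ≤ |coeff (Finsupp.single 0 e) Q|)
    (δ : ℝ) (hδ : 0 < δ) (a : Fin (m+1) → ℝ) (L : ℝ) (hL : 0 ≤ L) :
    volume {x : Fin (m+1) → ℝ | |eval x Q| ≤ δ ∧ ∀ i, x i ∈ Set.Icc (a i) (a i + L)} ≤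
      ENNReal.ofReal (L ^ m * (2 * e * δ ^ (1 / (e : ℝ)))) := by
  set S := {x : Fin (m+1) → ℝ | |eval x Q| ≤ δ ∧ ∀ i, x i ∈ Set.Icc (a i) (a i + L)} with hS
  have hSm : MeasurableSet S := by
    have : S = {x | |eval x Q| ≤ δ} ∩ Set.Icc a (fun i => a i + L) := by
      ext x; simp [hS, Pi.le_def, forall_and]
    rw [this]
    refine (IsClosed.measurableSet ?_).inter measurableSet_Icc
    exact isClosed_le (MvPolynomial.continuous_eval Q).abs continuous_const
  have mp := (volume_preserving_piFinSuccAbove (fun _ : Fin (m+1) => ℝ) 0)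
  have mps := mp.symm
  rw [← mps.measure_preimage hSm.nullMeasurableSet]
  rw [Measure.volume_eq_prod, Measure.prod_apply_symm (mps.measurable hSm)]
  have hb : ∀ y : Fin m → ℝ, volume ((fun x => (x, y)) ⁻¹'
      ((MeasurableEquiv.piFinSuccAbove (fun _ : Fin (m+1) => ℝ) 0).symm ⁻¹' S)) ≤
      (Set.Icc (fun i => a (Fin.succ i)) (fun i => a (Fin.succ i) + L)).indicator
        (fun _ => ENNReal.ofReal (2 * e * δ ^ (1 / (e : ℝ)))) y := by
    intro y
    by_cases hy : y ∈ Set.Icc (fun i => a (Fin.succ i)) (fun i => a (Fin.succ i) + L)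
    · rw [Set.indicator_of_mem hy]
      have hq := slicePoly_natDegree_le Q 0 (Fin.cons 0 y) e hdeg
      have hc := slicePoly_coeff Q 0 (Fin.cons 0 y) e hdeg
      have hq' : (slicePoly Q 0 (Fin.cons 0 y)).natDegree = e := by
        apply le_antisymm hq
        apply Polynomial.le_natDegree_of_ne_zero
        rw [hc]; intro h; rw [h] at hco; norm_num at hco
      refine le_trans (measure_mono ?_) (poly_sublevel_volume (slicePoly Q 0 (Fin.cons 0 y)) e he hq'
        (by rw [Polynomial.leadingCoeff, hq', hc]; exact hco) δ hδ)
      intro t ht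
      simp only [Set.mem_preimage, hS, Set.mem_ofPred_eq] at ht
      simp only [Set.mem_ofPred_eq, slicePoly_eval]
      have := ht.1
      simpa [Fin.insertNthEquiv, MeasurableEquiv.piFinSuccAbove] using this
    · rw [Set.indicator_of_notMem hy]
      simp only [nonpos_iff_eq_zero]
      convert measure_empty (μ := volume)
      ext t
      simp only [Set.mem_preimage, hS, Set.mem_ofPred_eq, Set.mem_empty_iff_false, iff_false]
      rintro ⟨-, h⟩
      apply hy
      rw [Set.mem_Icc, Pi.le_def, Pi.le_def]
      refine ⟨fun i => ?_, fun i => ?_⟩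
      · have := (h (Fin.succ i)).1
        simpa [Fin.insertNthEquiv, MeasurableEquiv.piFinSuccAbove] using this
      · have := (h (Fin.succ i)).2
        simpa [Fin.insertNthEquiv, MeasurableEquiv.piFinSuccAbove] using this
  refine (lintegral_mono hb).trans ?_
  rw [lintegral_indicator measurableSet_Icc, setLIntegral_const, Real.volume_Icc_pi]
  simp only [add_sub_cancel_left, Finset.prod_const, Finset.card_univ, Fintype.card_fin]
  rw [← ENNReal.ofReal_pow hL, ← ENNReal.ofReal_mul (by positivity)]
  apply le_of_eq; congr 1; ring


/-- number of common zeros of `c X_i^N + lower` is at most `N^n` -/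
lemma card_zeros_le {n N : ℕ} (G : Fin n → MvPolynomial (Fin n) ℝ) (c : ℝ) (hc : c ≠ 0)
    (H : Fin n → MvPolynomial (Fin n) ℝ) (hH : ∀ i, (H i).totalDegree < N)
    (hG : ∀ i, G i = C c * X i ^ N + H i) (S : Finset (Fin n → ℝ))
    (hS : ∀ s ∈ S, ∀ i, eval s (G i) = 0) : S.card ≤ N ^ n := by
  classical
  let ev : MvPolynomial (Fin n) ℝ →ₐ[ℝ] (S → ℝ) := AlgHom.pi (fun s : S => MvPolynomial.aeval (R := ℝ) s.1)
  have ev_apply : ∀ p s, ev p s = eval s.1 p := by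
    intro p s; simp [ev]
  let b : (Fin n → Fin N) → (S → ℝ) := fun m => ev (∏ i, X i ^ (m i : ℕ))
  let W := Submodule.span ℝ (Set.range b)
  have step : ∀ D : ℕ, ∀ p : MvPolynomial (Fin n) ℝ, p.totalDegree < D → ev p ∈ W := by
    intro D
    induction D with
    | zero => intro p hp; omega
    | succ D ih =>
      intro p hp
      rw [p.as_sum, map_sum]
      refine Submodule.sum_mem _ fun m hm => ?_
      have hmd : m.degree ≤ D := by
        have : m.degree ≤ _ := le_totalDegree hm
        omega
      by_cases hall : ∀ i, m i < N
      · have : monomial m (coeff m p) = C (coeff m p) * ∏ i, X i ^ (m i) := by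
          rw [monomial_eq, Finsupp.prod_fintype _ _ (by simp)]
        rw [this, ← MvPolynomial.smul_eq_C_mul, map_smul]
        refine Submodule.smul_mem _ _ (Submodule.subset_span ⟨fun i => ⟨m i, hall i⟩, rfl⟩)
      · push Not at hall
        obtain ⟨i, hi⟩ := hall
        have hle : Finsupp.single i N ≤ m := by
          rw [Finsupp.single_le_iff]; exact hi
        obtain ⟨m', rfl⟩ := exists_add_of_le hle
        have hN : 0 < N := by have := hH i; omega
        have e1 : ev (monomial (Finsupp.single i N + m') (coeff (Finsupp.single i N + m') p)) =
            ev (C (-(coeff (Finsupp.single i N + m') p) / c) * (monomial m' 1 * H i)) := by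
          ext s
          rw [ev_apply, ev_apply]
          have := hS s.1 s.2 i
          rw [hG] at this
          simp only [map_add, map_mul, eval_C, map_pow, eval_X] at this
          have h2 : eval s.1 (H i) = - (c * s.1 i ^ N) := by linarith
          have h3 : eval s.1 (monomial (Finsupp.single i N + m') (coeff (Finsupp.single i N + m') p))
            = coeff (Finsupp.single i N + m') p * (s.1 i ^ N * eval s.1 (monomial m' (1:ℝ))) := by
            rw [show monomial (Finsupp.single i N + m') (coeff (Finsupp.single i N + m') p) =
              C (coeff (Finsupp.single i N + m') p) * (X i ^ N * monomial m' 1) by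
                rw [X_pow_eq_monomial, monomial_mul, C_mul_monomial]; simp]
            simp only [map_mul, eval_C, map_pow, eval_X]
          rw [h3]
          simp only [map_mul, eval_C, h2]
          field_simp
        rw [e1, ← MvPolynomial.smul_eq_C_mul, map_smul]
        refine Submodule.smul_mem _ _ (ih _ ?_)
        refine lt_of_le_of_lt (totalDegree_mul _ _) ?_
        have h4 : (monomial m' (1:ℝ)).totalDegree ≤ m'.degree := totalDegree_monomial_le _ _
        have h5 : (Finsupp.single i N + m').degree = N + m'.degree := by
          rw [map_add, Finsupp.degree_single]
        have := hH i
        omega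
  have htop : W = ⊤ := by
    rw [eq_top_iff]
    intro f _
    have hf : f = ∑ s : S, f s • (Pi.single s 1 : S → ℝ) := by
      ext t; simp [Finset.sum_apply, Pi.single_apply]
    rw [hf]
    refine Submodule.sum_mem _ fun s _ => Submodule.smul_mem _ _ ?_
    have hsep : ∀ t : S, t ≠ s → ∃ p : MvPolynomial (Fin n) ℝ, eval s.1 p = 1 ∧ eval t.1 p = 0 := by
      intro t ht
      have : ∃ i, s.1 i ≠ t.1 i := by
        by_contra! h
        exact ht (Subtype.ext (funext h)).symm
      obtain ⟨i, hi⟩ := this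
      have h0 : s.1 i - t.1 i ≠ 0 := sub_ne_zero.mpr hi
      refine ⟨C (1 / (s.1 i - t.1 i)) * (X i - C (t.1 i)), ?_, ?_⟩
      · simp only [map_mul, eval_C, map_sub, eval_X]; field_simp
      · simp
    choose! φ hφ1 hφ2 using hsep
    let p : MvPolynomial (Fin n) ℝ := ∏ t ∈ Finset.univ.erase s, φ t
    have : (Pi.single s 1 : S → ℝ) = ev p := by
      ext u
      rw [ev_apply]
      simp only [p, map_prod]
      by_cases hu : u = s
      · subst hu
        rw [Pi.single_eq_same, Finset.prod_eq_one]
        intro t ht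
        exact hφ1 t (Finset.ne_of_mem_erase ht)
      · rw [Pi.single_eq_of_ne hu, Finset.prod_eq_zero (i := u)]
        · simp [hu]
        · exact hφ2 u hu
    rw [this]
    exact step _ p (Nat.lt_succ_self _)
  have h1 : Module.finrank ℝ (S → ℝ) = S.card := by simp
  have h2 : Module.finrank ℝ W ≤ Fintype.card (Fin n → Fin N) := finrank_range_le_card b
  rw [htop, finrank_top, h1] at h2
  simpa using h2

lemma hasDerivAt_eval_update {n : ℕ} (P : MvPolynomial (Fin n) ℝ) (i : Fin n) (x : Fin n → ℝ) :
    HasDerivAt (fun t => eval (Function.update x i t) P) (eval x (pderiv i P)) (x i) := by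
  have h := (slicePoly P i x).hasDerivAt (x i)
  rw [slicePoly_derivative, slicePoly_eval, Function.update_eq_self] at h
  simpa only [slicePoly_eval] using h

lemma totalDegree_pderiv_le {n : ℕ} (P : MvPolynomial (Fin n) ℝ) (i : Fin n) (D : ℕ)
    (hD : P.totalDegree ≤ D) : (pderiv i P).totalDegree ≤ D - 1 := by
  classical
  rw [P.as_sum, map_sum]
  refine totalDegree_finsetSum_le fun m hm => ?_
  rw [pderiv_monomial]
  by_cases h0 : m i = 0
  · simp [h0]
  refine (totalDegree_monomial_le _ _).trans ?_
  have h1 : m.degree ≤ P.totalDegree := le_totalDegree hm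
  have hle : Finsupp.single i 1 ≤ m := by rw [Finsupp.single_le_iff]; omega
  obtain ⟨m', rfl⟩ := exists_add_of_le hle
  have h5 : (Finsupp.single i 1 + m').degree = 1 + m'.degree := by
    rw [map_add, Finsupp.degree_single]
  rw [add_tsub_cancel_left]
  change m'.degree ≤ _
  omega

/-- A polynomial has a bounded number of isolated pieces of its zero set. -/
lemma card_pieces_le {n e : ℕ} (he : 1 ≤ e) (f : MvPolynomial (Fin n) ℝ) (hdeg : f.totalDegree < 2 * e)
    (hf : ∀ x, 0 ≤ eval x f) {ι : Type*} (A : Finset ι) (K U : ι → Set (Fin n → ℝ))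
    (hK : ∀ j ∈ A, IsCompact (K j)) (hU : ∀ j ∈ A, IsOpen (U j)) (hUK : ∀ j ∈ A, U j ⊆ K j)
    (hdisj : ∀ j ∈ A, ∀ l ∈ A, j ≠ l → Disjoint (U j) (U l))
    (hz : ∀ j ∈ A, ∃ x ∈ U j, eval x f = 0)
    (hpos : ∀ j ∈ A, ∀ x ∈ K j, x ∉ U j → eval x f ≠ 0) :
    A.card ≤ (2 * e - 1) ^ n := by
  classical
  let h : MvPolynomial (Fin n) ℝ := ∑ i, X i ^ (2 * e)
  have hh : ∀ x, 0 ≤ eval x h := by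
    intro x; simp only [h, map_sum, map_pow, eval_X]
    exact Finset.sum_nonneg fun i _ => by rw [pow_mul]; positivity
  have hε : ∀ j ∈ A, ∀ᶠ ε in nhdsWithin (0:ℝ) (Set.Ioi 0),
      ∃ q ∈ U j, IsLocalMin (fun x => eval x (f + C ε * h)) q := by
    intro j hj
    obtain ⟨p, hpU, hp⟩ := hz j hj
    have hcpt : IsCompact (K j \ U j) := (hK j hj).diff (hU j hj)
    have hm : ∃ m : ℝ, 0 < m ∧ ∀ x ∈ K j \ U j, m ≤ eval x f := by
      by_cases hne : (K j \ U j).Nonempty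
      · obtain ⟨y, hy, hmin⟩ := hcpt.exists_isMinOn hne (MvPolynomial.continuous_eval f).continuousOn
        refine ⟨eval y f, lt_of_le_of_ne (hf y) (hpos j hj y hy.1 hy.2).symm, fun x hx => hmin hx⟩
      · exact ⟨1, one_pos, fun x hx => absurd ⟨x, hx⟩ hne⟩
    obtain ⟨m, hm0, hm⟩ := hm
    have ht : Tendsto (fun ε : ℝ => ε * eval p h) (nhdsWithin (0:ℝ) (Set.Ioi 0)) (nhds 0) := by
      have : Tendsto (fun ε : ℝ => ε * eval p h) (nhds 0) (nhds (0 * eval p h)) :=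
        (continuous_id.mul continuous_const).tendsto 0
      rw [zero_mul] at this
      exact this.mono_left nhdsWithin_le_nhds
    filter_upwards [ht.eventually_lt_const hm0, self_mem_nhdsWithin] with ε h1 h2
    have h2' : (0:ℝ) < ε := h2
    obtain ⟨q, hqK, hq⟩ := (hK j hj).exists_isMinOn ⟨p, hUK j hj hpU⟩
      (MvPolynomial.continuous_eval (f + C ε * h)).continuousOn
    have hqp : eval q (f + C ε * h) ≤ eval p (f + C ε * h) := hq (hUK j hj hpU)
    simp only [map_add, map_mul, eval_C, hp, zero_add] at hqp
    have hqU : q ∈ U j := by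
      by_contra hcon
      have := hm q ⟨hqK, hcon⟩
      have := mul_nonneg h2'.le (hh q)
      linarith
    exact ⟨q, hqU, hq.isLocalMin (mem_of_superset ((hU j hj).mem_nhds hqU) (hUK j hj))⟩
  have hall := (Filter.eventually_all_finset A).mpr hε
  obtain ⟨ε, hε1, hε2⟩ := (hall.and self_mem_nhdsWithin).exists
  have hε0 : (0:ℝ) < ε := hε2
  choose! q hqU hq using hε1
  have hinj : Set.InjOn q A := by
    intro j hj l hl hjl
    by_contra hne
    exact Set.disjoint_left.mp (hdisj j hj l hl hne) (hqU j hj) (hjl ▸ hqU l hl)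
  rw [← Finset.card_image_of_injOn hinj]
  refine card_zeros_le (fun i => pderiv i (f + C ε * h)) (ε * (2 * e : ℕ)) (by positivity)
    (fun i => pderiv i f) ?_ ?_ _ ?_
  · intro i
    have := totalDegree_pderiv_le f i (2 * e - 1) (by omega)
    omega
  · intro i
    simp only [map_add, h, Derivation.leibniz, pderiv_C, map_sum, Derivation.leibniz_pow, pderiv_X,
      smul_eq_mul, mul_zero, add_zero]
    rw [Finset.sum_eq_single i]
    · simp only [Pi.single_eq_same, map_mul, map_natCast, nsmul_eq_mul]; push_cast; ring
    · intro j _ hj; simp [hj]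
    · simp
  · intro s hs i
    obtain ⟨j, hj, rfl⟩ := Finset.mem_image.mp hs
    have hd := hasDerivAt_eval_update (f + C ε * h) i (q j)
    have hc : ContinuousAt (fun t : ℝ => Function.update (q j) i t) (q j i) :=
      (continuous_const.update i continuous_id).continuousAt
    have hl : IsLocalMin (fun t => eval (Function.update (q j) i t) (f + C ε * h)) (q j i) := by
      have h0 := hq j hj
      have h1 : Tendsto (fun t : ℝ => Function.update (q j) i t) (nhds (q j i)) (nhds (q j)) := by
        have := hc.tendsto; rwa [Function.update_eq_self] at this
      have := h1.eventually h0
      unfold IsLocalMin IsMinFilter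
      simpa using this
    exact hl.hasDerivAt_eq_zero hd


/-- Counting lemma: number of unit grid cubes meeting an algebraic set. -/
lemma card_cubes_le {n e s : ℕ} (he : 2 ≤ e) (f : MvPolynomial (Fin n) ℝ)
    (hdeg : f.totalDegree < 2 * e) (hf : ∀ x, 0 ≤ eval x f) (t : Fin n → ℝ)
    (hgen : ∀ x, eval x f = 0 → ∀ I : Finset (Fin n), (∀ i ∈ I, ∃ w : ℤ, x i = t i + w) →
      I.card ≤ s)
    (K : ℕ) (A : Finset (Fin n → ℤ)) (hAK : ∀ z ∈ A, ∀ i, |z i| ≤ K)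
    (hA : ∀ z ∈ A, ∃ x, eval x f = 0 ∧ ∀ i, x i ∈ Set.Icc (t i + z i) (t i + z i + 1)) :
    A.card ≤ (2 * e - 1) ^ n * (2 ^ n * (2 * K + 3) ^ s * 2 ^ n) := by
  classical
  let J : (Fin n → ℝ) → Finset (Fin n) := fun x =>
    Finset.univ.filter (fun i => ∃ w : ℤ, x i = t i + w)
  have hmax : ∀ z ∈ A, ∃ x, eval x f = 0 ∧ (∀ i, x i ∈ Set.Icc (t i + z i) (t i + z i + 1)) ∧
      ∀ y, eval y f = 0 → (∀ i, y i ∈ Set.Icc (t i + z i) (t i + z i + 1)) →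
        (J y).card ≤ (J x).card := by
    intro z hz
    let S : Set ℕ := {c | ∃ x, eval x f = 0 ∧
      (∀ i, x i ∈ Set.Icc (t i + z i) (t i + z i + 1)) ∧ (J x).card = c}
    have hne : S.Nonempty := by
      obtain ⟨x, h1, h2⟩ := hA z hz
      exact ⟨_, x, h1, h2, rfl⟩
    have hbdd : BddAbove S := by
      refine ⟨n, ?_⟩
      rintro c ⟨x, _, _, rfl⟩
      simpa using Finset.card_le_univ (J x)
    obtain ⟨x, h1, h2, h3⟩ := Nat.sSup_mem hne hbdd
    refine ⟨x, h1, h2, fun y hy1 hy2 => ?_⟩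
    rw [h3]
    exact le_csSup hbdd ⟨y, hy1, hy2, rfl⟩
  choose! x hx0 hxQ hxmax using hmax
  let fl : (Fin n → ℤ) → Fin n → ℤ := fun z i => ⌊x z i - t i⌋
  let key : (Fin n → ℤ) → (Finset (Fin n) × (Fin n → ℤ)) × (Fin n → ℤ) := fun z =>
    ((J (x z), fun i => if i ∈ J (x z) then fl z i else 0), fun i => fl z i - z i)
  -- basic facts on the floor
  have hflJ : ∀ z, ∀ i ∈ J (x z), x z i = t i + fl z i := by
    intro z i hi
    obtain ⟨w, hw⟩ := (Finset.mem_filter.mp hi).2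
    have : fl z i = w := by simp only [fl]; rw [hw]; simp
    rw [this, hw]
  have hfl0 : ∀ z ∈ A, ∀ i, fl z i - z i = 0 ∨ fl z i - z i = 1 := by
    intro z hz i
    have h := hxQ z hz i
    have h1 : z i ≤ fl z i := by
      simp only [fl]; rw [Int.le_floor]; linarith [h.1]
    have h2 : fl z i < z i + 2 := by
      simp only [fl]; rw [Int.floor_lt]; push_cast; linarith [h.2]
    omega
  have hflN : ∀ z ∈ A, ∀ i, i ∉ J (x z) → fl z i = z i ∧ t i + z i < x z i ∧
      x z i < t i + z i + 1 := by
    intro z hz i hi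
    have h := hxQ z hz i
    have hi' : ∀ w : ℤ, x z i ≠ t i + w := by
      intro w hw; exact hi (Finset.mem_filter.mpr ⟨Finset.mem_univ _, w, hw⟩)
    have h1 : t i + z i < x z i := lt_of_le_of_ne h.1 (hi' _).symm
    have h2 : x z i < t i + z i + 1 := lt_of_le_of_ne h.2 (by
      have := hi' (z i + 1); push_cast at this; rwa [← add_assoc] at this)
    refine ⟨?_, h1, h2⟩
    simp only [fl]
    rw [Int.floor_eq_iff]
    constructor <;> linarith
  let T1 : Finset (Finset (Fin n) × (Fin n → ℤ)) :=
    (Finset.univ.filter (fun I : Finset (Fin n) => I.card ≤ s)).biUnion (fun I =>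
      (Fintype.piFinset (fun i => if i ∈ I then Finset.Icc (-((K:ℤ)+1)) (K+1) else {0})).image
        (fun w => (I, w)))
  let T := T1 ×ˢ (Fintype.piFinset (fun _ : Fin n => Finset.Icc (0:ℤ) 1))
  have hT1 : T1.card ≤ 2 ^ n * (2 * K + 3) ^ s := by
    refine (Finset.card_biUnion_le_card_mul _ _ ((2 * K + 3) ^ s) ?_).trans ?_
    · intro I hI
      refine Finset.card_image_le.trans ?_
      rw [Fintype.card_piFinset]
      have : ∀ i : Fin n, (if i ∈ I then Finset.Icc (-((K:ℤ)+1)) (K+1) else {0}).card =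
          if i ∈ I then 2 * K + 3 else 1 := by
        intro i
        split_ifs
        · rw [Int.card_Icc]; omega
        · simp
      simp only [this]
      rw [Finset.prod_ite_mem, Finset.univ_inter, Finset.prod_const]
      exact Nat.pow_le_pow_right (by omega) (Finset.mem_filter.mp hI).2
    · gcongr
      refine (Finset.card_filter_le _ _).trans ?_
      simp
  have hT : T.card ≤ 2 ^ n * (2 * K + 3) ^ s * 2 ^ n := by
    simp only [T]
    rw [Finset.card_product, Fintype.card_piFinset]
    simp only [Int.card_Icc, Finset.prod_const, Finset.card_univ, Fintype.card_fin]
    gcongr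
    norm_num
  have hmaps : ∀ z ∈ A, key z ∈ T := by
    intro z hz
    simp only [T, key, Finset.mem_product, Fintype.mem_piFinset, T1, Finset.mem_biUnion,
      Finset.mem_image]
    refine ⟨⟨J (x z), ?_, _, ?_, rfl⟩, ?_⟩
    · refine Finset.mem_filter.mpr ⟨Finset.mem_univ _, ?_⟩
      exact hgen (x z) (hx0 z hz) _ (fun i hi => (Finset.mem_filter.mp hi).2)
    · intro i
      have h1 := hAK z hz i
      have h2 := hfl0 z hz i
      rw [abs_le] at h1
      split_ifs
      · rw [Finset.mem_Icc]; omega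
      · simp
    · intro i
      have h2 := hfl0 z hz i
      rw [Finset.mem_Icc]; omega
  refine (Finset.card_le_mul_card_image_of_maps_to hmaps ((2 * e - 1) ^ n) ?_).trans
    (Nat.mul_le_mul_left _ hT)
  rintro ⟨⟨I, w⟩, u⟩ _
  set B := A.filter (fun z => key z = ((I, w), u)) with hB
  have hBA : ∀ z ∈ B, z ∈ A := fun z hz => (Finset.mem_filter.mp hz).1
  have hBI : ∀ z ∈ B, J (x z) = I := fun z hz => by
    have := (Finset.mem_filter.mp hz).2
    simp only [key, Prod.mk.injEq] at this
    exact this.1.1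
  have hBw : ∀ z ∈ B, ∀ i ∈ I, fl z i = w i := fun z hz i hi => by
    have h0 := hBI z hz
    have := (Finset.mem_filter.mp hz).2
    simp only [key, Prod.mk.injEq, h0] at this
    have := congrFun this.1.2 i
    simpa [hi] using this
  have hBu : ∀ z ∈ B, ∀ i, fl z i - z i = u i := fun z hz i => by
    have := (Finset.mem_filter.mp hz).2
    simp only [key, Prod.mk.injEq] at this
    exact congrFun this.2 i
  let g : MvPolynomial (Fin n) ℝ := f + ∑ i ∈ I, (X i - C (t i + w i)) ^ 2
  have hgeval : ∀ y, eval y g = eval y f + ∑ i ∈ I, (y i - (t i + w i)) ^ 2 := by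
    intro y; simp [g]
  have hg0 : ∀ y, eval y g = 0 ↔ eval y f = 0 ∧ ∀ i ∈ I, y i = t i + w i := by
    intro y
    rw [hgeval]
    have hs : 0 ≤ ∑ i ∈ I, (y i - (t i + w i)) ^ 2 := Finset.sum_nonneg fun i _ => sq_nonneg _
    constructor
    · intro h
      have h1 := hf y
      have h2 : ∑ i ∈ I, (y i - (t i + w i)) ^ 2 = 0 := by linarith
      refine ⟨by linarith, fun i hi => ?_⟩
      have := (Finset.sum_eq_zero_iff_of_nonneg (fun i _ => sq_nonneg _)).mp h2 i hi
      have := pow_eq_zero_iff (two_ne_zero) |>.mp this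
      linarith
    · rintro ⟨h1, h2⟩
      rw [h1, Finset.sum_eq_zero, add_zero]
      intro i hi; rw [h2 i hi]; ring
  let lo : (Fin n → ℤ) → Fin n → ℝ := fun z i => if i ∈ I then t i + w i - 1/2 else t i + z i
  let hi' : (Fin n → ℤ) → Fin n → ℝ := fun z i => if i ∈ I then t i + w i + 1/2 else t i + z i + 1
  refine card_pieces_le (e := e) (by omega) g ?_ ?_ B (fun z => Set.Icc (lo z) (hi' z))
    (fun z => Set.pi Set.univ fun i => Set.Ioo (lo z i) (hi' z i)) ?_ ?_ ?_ ?_ ?_ ?_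
  · simp only [g]
    refine lt_of_le_of_lt (totalDegree_add _ _) (max_lt hdeg ?_)
    refine lt_of_le_of_lt (totalDegree_finsetSum_le (d := 2) fun i _ => ?_) (by omega)
    refine (totalDegree_pow _ _).trans ?_
    have : (X i - C (t i + w i) : MvPolynomial (Fin n) ℝ).totalDegree ≤ 1 := by
      refine (totalDegree_sub _ _).trans ?_
      rw [totalDegree_C, totalDegree_X]; norm_num
    omega
  · intro y
    rw [hgeval]
    exact add_nonneg (hf y) (Finset.sum_nonneg fun i _ => sq_nonneg _)
  · intro z _; exact isCompact_Icc
  · intro z _; exact isOpen_set_pi Set.finite_univ fun i _ => isOpen_Ioo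
  · intro z _ y hy
    rw [Set.mem_Icc, Pi.le_def, Pi.le_def]
    exact ⟨fun i => (hy i trivial).1.le, fun i => (hy i trivial).2.le⟩
  · intro z hz l hl hzl
    rw [Set.disjoint_left]
    intro y hy1 hy2
    apply hzl
    ext i
    by_cases hiI : i ∈ I
    · have h1 := hBw z hz i hiI
      have h2 := hBw l hl i hiI
      have h3 := hBu z hz i
      have h4 := hBu l hl i
      omega
    · have h1 := hy1 i trivial
      have h2 := hy2 i trivial
      simp only [lo, hi', hiI, if_false, Set.mem_Ioo] at h1 h2
      have h3 : (z i : ℝ) < l i + 1 := by linarith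
      have h4 : (l i : ℝ) < z i + 1 := by linarith
      norm_cast at h3 h4
      omega
  · intro z hz
    have hJ := hBI z hz
    refine ⟨x z, ?_, ?_⟩
    · intro i _
      by_cases hiI : i ∈ I
      · have h1 := hflJ z i (by rw [hJ]; exact hiI)
        rw [hBw z hz i hiI] at h1
        simp only [lo, hi', hiI, if_true, Set.mem_Ioo]
        constructor <;> linarith
      · have := hflN z (hBA z hz) i (by rw [hJ]; exact hiI)
        simp only [lo, hi', hiI, if_false, Set.mem_Ioo]
        exact this.2
    · rw [hg0]
      refine ⟨hx0 z (hBA z hz), fun i hiI => ?_⟩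
      have h1 := hflJ z i (by rw [hJ]; exact hiI)
      rwa [hBw z hz i hiI] at h1
  · intro z hz y hy hyU hgy
    apply hyU
    rw [hg0] at hgy
    obtain ⟨hfy, hyI⟩ := hgy
    have hJ := hBI z hz
    rw [Set.mem_Icc, Pi.le_def, Pi.le_def] at hy
    have hyQ : ∀ i, y i ∈ Set.Icc (t i + z i) (t i + z i + 1) := by
      intro i
      by_cases hiI : i ∈ I
      · have h1 := hflJ z i (by rw [hJ]; exact hiI)
        rw [hBw z hz i hiI, ← hyI i hiI] at h1
        rw [← h1]; exact hxQ z (hBA z hz) i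
      · have h1 := hy.1 i
        have h2 := hy.2 i
        simp only [lo, hi', hiI, if_false] at h1 h2
        exact ⟨h1, h2⟩
    have hcard := hxmax z (hBA z hz) y hfy hyQ
    have hsub : I ⊆ J y := fun i hi =>
      Finset.mem_filter.mpr ⟨Finset.mem_univ _, w i, hyI i hi⟩
    rw [hJ] at hcard
    have hJy : I = J y := Finset.eq_of_subset_of_card_le hsub hcard
    intro i _
    by_cases hiI : i ∈ I
    · simp only [lo, hi', hiI, if_true, Set.mem_Ioo]
      rw [hyI i hiI]
      constructor <;> linarith
    · simp only [lo, hi', hiI, if_false, Set.mem_Ioo]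
      have hn : ∀ v : ℤ, y i ≠ t i + v := by
        intro v hv
        apply hiI; rw [hJy]
        exact Finset.mem_filter.mpr ⟨Finset.mem_univ _, v, hv⟩
      refine ⟨lt_of_le_of_ne (hyQ i).1 (hn _).symm, lt_of_le_of_ne (hyQ i).2 ?_⟩
      have := hn (z i + 1); push_cast at this; rwa [← add_assoc] at this


lemma exists_generic {n s : ℕ} (S : Set (EuclideanSpace ℝ (Fin n)))
    (hS : dimH S < ((s + 1 : ℕ) : ℝ≥0∞)) :
    ∃ t : Fin n → ℝ, ∀ x ∈ S, ∀ I : Finset (Fin n), (∀ i ∈ I, ∃ w : ℤ, x i = t i + w) →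
      I.card ≤ s := by
  classical
  have key : ∀ I : Finset (Fin n), I.card = s + 1 → ∀ᵐ t : Fin n → ℝ,
      ∀ x ∈ S, ¬ ∀ i ∈ I, ∃ w : ℤ, x i = t i + w := by
    intro I hI
    have hY : ∀ w : {i // i ∈ I} → ℤ, volume ((fun (x : EuclideanSpace ℝ (Fin n)) (i : {i // i ∈ I}) => x i - w i) '' S) = 0 := by
      intro w
      have hlip : LipschitzWith 1 (fun (x : EuclideanSpace ℝ (Fin n)) (i : {i // i ∈ I}) => x i - (w i : ℝ)) := by
        apply LipschitzWith.of_dist_le_mul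
        intro x y
        rw [NNReal.coe_one, one_mul, dist_pi_le_iff dist_nonneg]
        intro i
        rw [dist_sub_right]
        exact (PiLp.lipschitzWith_ofLp 2 (fun _ : Fin n => ℝ)).dist_le_mul x y |> fun h => by
          simpa using (dist_le_pi_dist x.ofLp y.ofLp i.1).trans (by simpa using h)
      have h1 := (hlip.dimH_image_le S).trans_lt hS
      have h2 := hausdorffMeasure_of_dimH_lt (d := ((s + 1 : ℕ) : ℝ≥0)) (by simpa using h1)
      have h3 := hausdorffMeasure_pi_real (ι := {i // i ∈ I})
      rw [Fintype.card_coe, hI] at h3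
      rw [← h3]
      simpa using h2
    have hq : Measure.QuasiMeasurePreserving (fun (t : Fin n → ℝ) (i : {i // i ∈ I}) => t i) := by
      have h1 := volume_preserving_piEquivPiSubtypeProd (fun _ : Fin n => ℝ) (fun i => i ∈ I)
      have h2 := h1.quasiMeasurePreserving
      rw [Measure.volume_eq_prod] at h2
      have h3 := Measure.quasiMeasurePreserving_fst.comp h2
      convert h3 <;> rfl
    have hall : ∀ᵐ t : Fin n → ℝ, ∀ w : {i // i ∈ I} → ℤ, (fun i : {i // i ∈ I} => t i) ∉
        ((fun (x : EuclideanSpace ℝ (Fin n)) (i : {i // i ∈ I}) => x i - (w i : ℝ)) '' S) := by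
      rw [ae_all_iff]
      intro w
      have := hq.preimage_null (hY w)
      exact measure_eq_zero_iff_ae_notMem.mp this
    filter_upwards [hall] with t ht x hx hcon
    choose! w hw using hcon
    refine ht (fun i => w i.1) ⟨x, hx, ?_⟩
    ext i
    simp [hw i.1 i.2]
  have hall : ∀ᵐ t : Fin n → ℝ, ∀ I : Finset (Fin n), I.card = s + 1 →
      ∀ x ∈ S, ¬ ∀ i ∈ I, ∃ w : ℤ, x i = t i + w := by
    rw [ae_all_iff]; intro I
    by_cases h : I.card = s + 1
    · filter_upwards [key I h] with t ht _ using ht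
    · exact Eventually.of_forall fun t h' => absurd h' h
  obtain ⟨t, ht⟩ := hall.exists
  refine ⟨t, fun x hx I hI => ?_⟩
  by_contra! hlt
  obtain ⟨I', hsub, hcard⟩ := Finset.exists_subset_card_eq (show s + 1 ≤ I.card by omega)
  exact ht I' hcard x hx fun i hi => hI i (hsub hi)

lemma const_sign {n k : ℕ} (P : MvPolynomial (Fin n) ℝ)
    (hk : dimH {x : EuclideanSpace ℝ (Fin n) | eval (fun i => x i) P = 0} = (k : ℝ≥0∞))
    (hkn : k + 1 < n) : (∀ x : EuclideanSpace ℝ (Fin n), 0 ≤ eval (fun i => x i) P) ∨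
      (∀ x : EuclideanSpace ℝ (Fin n), eval (fun i => x i) P ≤ 0) := by
  by_contra! hcon
  obtain ⟨⟨x, hx⟩, ⟨y, hy⟩⟩ := hcon
  let F : EuclideanSpace ℝ (Fin n) → ℝ := fun x => eval (fun i => x i) P
  have hF : Continuous F := (MvPolynomial.continuous_eval P).comp (by fun_prop)
  set v := y - x with hv
  have hv0 : v ≠ 0 := by
    intro h; rw [hv, sub_eq_zero] at h; rw [h] at hy; linarith
  let W := (Submodule.span ℝ {v})ᗮ
  let pr := W.orthogonalProjectionOnto
  have hfin : Module.finrank ℝ W = n - 1 := by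
    have h1 := Submodule.finrank_add_finrank_orthogonal (Submodule.span ℝ {v})
    rw [finrank_span_singleton hv0, finrank_euclideanSpace_fin] at h1
    change 1 + Module.finrank ℝ W = n at h1
    omega
  have hnhds : pr '' {x | F x = 0} ∈ nhds (pr x) := by
    have hc1 : Continuous (fun w : W => F (x + (w - pr x : W))) := by fun_prop
    have hc2 : Continuous (fun w : W => F (y + (w - pr x : W))) := by fun_prop
    have h1 : ∀ᶠ w in nhds (pr x), F (x + (w - pr x : W)) < 0 := by
      apply hc1.continuousAt.eventually_lt_const; simpa using hx
    have h2 : ∀ᶠ w in nhds (pr x), 0 < F (y + (w - pr x : W)) := by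
      apply hc2.continuousAt.eventually_const_lt; simpa using hy
    filter_upwards [h1, h2] with w hw1 hw2
    have hivt := intermediate_value_Icc (a := (0:ℝ)) (b := 1) zero_le_one
      (f := fun s : ℝ => F (x + (w - pr x : W) + s • v)) (by fun_prop)
    have hmem : (0:ℝ) ∈ Set.Icc (F (x + (w - pr x : W) + (0:ℝ) • v)) (F (x + (w - pr x : W) + (1:ℝ) • v)) := by
      constructor
      · simpa using hw1.le
      · have : x + ((w - pr x : W) : EuclideanSpace ℝ (Fin n)) + (1:ℝ) • v = y + (w - pr x : W) := by
          rw [hv, one_smul]; abel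
        rw [this]; exact hw2.le
    obtain ⟨s, _, hs⟩ := hivt hmem
    refine ⟨_, hs, ?_⟩
    have hprv : pr v = 0 := by
      rw [Submodule.orthogonalProjectionOnto_eq_zero_iff]
      exact Submodule.le_orthogonal_orthogonal _ (Submodule.mem_span_singleton_self v)
    rw [map_add, map_add, map_smul, hprv, smul_zero, add_zero]
    have : pr ((w - pr x : W) : EuclideanSpace ℝ (Fin n)) = w - pr x :=
      Submodule.orthogonalProjectionOnto_mem_subspace_eq_self _
    rw [this]; abel
  have h1 := Real.dimH_of_mem_nhds hnhds
  have h2 := pr.lipschitz.dimH_image_le {x | F x = 0}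
  rw [h1, hfin] at h2
  have h3 : ((n - 1 : ℕ) : ℝ≥0∞) ≤ k := h2.trans hk.le
  have : n - 1 ≤ k := by exact_mod_cast h3
  omega


lemma eval_lipschitz {n : ℕ} (Q : MvPolynomial (Fin n) ℝ) (M : ℝ) :
    ∃ L > 0, ∃ B > 0, ∀ x y : Fin n → ℝ, ‖x‖ ≤ M → ‖y‖ ≤ M →
      |eval x Q| ≤ B ∧ |eval x Q - eval y Q| ≤ L * ‖x - y‖ := by
  induction Q using MvPolynomial.induction_on with
  | C a =>
    refine ⟨1, one_pos, |a| + 1, by positivity, fun x y _ _ => ⟨by simp, ?_⟩⟩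
    simp
  | add p q hp hq =>
    obtain ⟨L1, hL1, B1, hB1, h1⟩ := hp
    obtain ⟨L2, hL2, B2, hB2, h2⟩ := hq
    refine ⟨L1 + L2, by positivity, B1 + B2, by positivity, fun x y hx hy => ⟨?_, ?_⟩⟩
    · rw [map_add]
      exact (abs_add_le _ _).trans (add_le_add (h1 x y hx hy).1 (h2 x y hx hy).1)
    · rw [map_add, map_add, add_sub_add_comm, add_mul]
      exact (abs_add_le _ _).trans (add_le_add (h1 x y hx hy).2 (h2 x y hx hy).2)
  | mul_X p j hp =>
    obtain ⟨L1, hL1, B1, hB1, h1⟩ := hp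
    refine ⟨L1 * (|M| + 1) + B1, by positivity, B1 * (|M| + 1), by positivity, fun x y hx hy => ⟨?_, ?_⟩⟩
    · rw [map_mul, eval_X, abs_mul]
      have hxj : |x j| ≤ |M| + 1 := by
        have := norm_le_pi_norm x j
        rw [Real.norm_eq_abs] at this
        linarith [le_abs_self M]
      exact mul_le_mul (h1 x y hx hy).1 hxj (abs_nonneg _) hB1.le
    · rw [map_mul, map_mul, eval_X, eval_X]
      have hxj : |x j| ≤ |M| + 1 := by
        have := norm_le_pi_norm x j
        rw [Real.norm_eq_abs] at this
        linarith [le_abs_self M]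
      have hxy : |x j - y j| ≤ ‖x - y‖ := norm_le_pi_norm (x - y) j
      have e1 : eval x p * x j - eval y p * y j =
        (eval x p - eval y p) * x j + eval y p * (x j - y j) := by ring
      rw [e1]
      refine (abs_add_le _ _).trans ?_
      rw [abs_mul, abs_mul, add_mul]
      refine add_le_add ?_ ?_
      · calc _ ≤ (L1 * ‖x - y‖) * (|M| + 1) :=
              mul_le_mul (h1 x y hx hy).2 hxj (abs_nonneg _) (by positivity)
          _ = _ := by ring
      · exact mul_le_mul (h1 y x hy hx).1 hxy (abs_nonneg _) hB1.le

lemma dimH_bounded_zero_le {m : ℕ} (Q : MvPolynomial (Fin (m+1)) ℝ) (e : ℕ) (he : 1 ≤ e)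
    (hdeg : Q.totalDegree ≤ e) (hco : 1 ≤ |coeff (Finsupp.single 0 e) Q|) (M : ℕ) (s : ℝ≥0)
    (hs : (s : ℝ) = (m + 1 : ℕ) - 1 / (e : ℝ)) :
    dimH {x : Fin (m+1) → ℝ | eval x Q = 0 ∧ ‖x‖ ≤ M} ≤ s := by
  classical
  obtain ⟨L, hL, _, _, hLip⟩ := eval_lipschitz Q ((M:ℝ) + 1)
  set S := {x : Fin (m+1) → ℝ | eval x Q = 0 ∧ ‖x‖ ≤ M} with hS
  let h : ℕ → ℝ := fun N => 1 / ((N : ℝ) + 1)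
  have hh : ∀ N, 0 < h N := fun N => by simp only [h]; positivity
  have hh1 : ∀ N, h N ≤ 1 := fun N => by
    simp only [h]; rw [div_le_one (by positivity)]; linarith [(Nat.cast_nonneg N : (0:ℝ) ≤ N)]
  have hhN : ∀ N, h N * ((N:ℝ) + 1) = 1 := fun N => by simp only [h]; field_simp
  let cell : ℕ → (Fin (m+1) → ℤ) → Set (Fin (m+1) → ℝ) := fun N z =>
    Set.pi Set.univ fun i => Set.Ico (z i * h N) ((z i + 1) * h N)
  let A : ℕ → Finset (Fin (m+1) → ℤ) := fun N =>
    (Fintype.piFinset fun _ => Finset.Icc (-((M * (N+1) : ℕ) : ℤ)) ((M * (N+1) : ℕ) : ℤ)).filter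
      (fun z => (cell N z ∩ S).Nonempty)
  let C0 : ℝ := (2 * ((M:ℝ) + 1)) ^ m * (2 * e * L ^ (1 / (e:ℝ)))
  have hdist : ∀ N z, ∀ x ∈ cell N z, ∀ y ∈ cell N z, ‖x - y‖ ≤ h N := by
    intro N z x hx y hy
    rw [pi_norm_le_iff_of_nonneg (hh N).le]
    intro i
    have h1 := hx i trivial
    have h2 := hy i trivial
    rw [Set.mem_Ico] at h1 h2
    rw [Pi.sub_apply, Real.norm_eq_abs, abs_le]
    constructor <;> linarith [h1.1, h1.2, h2.1, h2.2]
  have hdiam : ∀ N z, ediam (cell N z) ≤ ENNReal.ofReal (h N) := by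
    intro N z
    refine ediam_le fun x hx y hy => ?_
    rw [edist_dist, dist_eq_norm]
    exact ENNReal.ofReal_le_ofReal (hdist N z x hx y hy)
  have hcard : ∀ N, ((A N).card : ℝ) * h N ^ (s : ℝ) ≤ C0 := by
    intro N
    have hvol : ∑ z ∈ A N, volume (cell N z) ≤
        ENNReal.ofReal ((2 * ((M:ℝ) + 1)) ^ m * (2 * e * (L * h N) ^ (1 / (e : ℝ)))) := by
      rw [← measure_biUnion_finset]
      · refine le_trans (measure_mono ?_) (box_sublevel_volume Q e he hdeg hco (L * h N)
          (mul_pos hL (hh N)) (fun _ => -((M:ℝ) + 1)) (2 * ((M:ℝ) + 1)) (by positivity))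
        intro x hx
        simp only [Set.mem_iUnion] at hx
        obtain ⟨z, hz, hxz⟩ := hx
        obtain ⟨y, hyz, hyS⟩ := (Finset.mem_filter.mp hz).2
        have hxy := hdist N z x hxz y hyz
        have hxn : ‖x‖ ≤ M + 1 := by
          have : ‖x‖ ≤ ‖y‖ + ‖x - y‖ := by
            have := norm_add_le y (x - y); simpa using this
          linarith [hyS.2, hh1 N]
        refine ⟨?_, fun i => ?_⟩
        · have := (hLip x y hxn (by linarith [hyS.2])).2
          rw [hyS.1, sub_zero] at this
          exact this.trans (by gcongr)
        · have := norm_le_pi_norm x i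
          rw [Real.norm_eq_abs] at this
          have := abs_le.mp (this.trans hxn)
          constructor <;> linarith [this.1, this.2]
      · intro z _ l _ hzl
        rw [Function.onFun, Set.disjoint_left]
        intro x hx1 hx2
        apply hzl
        ext i
        have h1 := hx1 i trivial
        have h2 := hx2 i trivial
        rw [Set.mem_Ico] at h1 h2
        have h3 : (z i : ℝ) < l i + 1 := by
          refine lt_of_mul_lt_mul_right (h1.1.trans_lt h2.2) (hh N).le
        have h4 : (l i : ℝ) < z i + 1 := by
          refine lt_of_mul_lt_mul_right (h2.1.trans_lt h1.2) (hh N).le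
        norm_cast at h3 h4
        omega
      · intro z _
        exact MeasurableSet.univ_pi fun i => measurableSet_Ico
    have hcv : ∀ z, volume (cell N z) = ENNReal.ofReal (h N ^ (m+1)) := by
      intro z
      simp only [cell]
      rw [Real.volume_pi_Ico]
      have : ∀ i, ((z i : ℝ) + 1) * h N - z i * h N = h N := fun i => by ring
      simp only [this, Finset.prod_const, Finset.card_univ, Fintype.card_fin]
      rw [ENNReal.ofReal_pow (hh N).le]
    simp only [hcv, Finset.sum_const, nsmul_eq_mul] at hvol
    rw [← ENNReal.ofReal_natCast, ← ENNReal.ofReal_mul (by positivity),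
      ENNReal.ofReal_le_ofReal_iff (by have := hh N; positivity)] at hvol
    rw [Real.mul_rpow hL.le (hh N).le] at hvol
    have hpos : 0 < h N ^ (1 / (e:ℝ)) := Real.rpow_pos_of_pos (hh N) _
    have hsplit : h N ^ (m+1) = h N ^ (s:ℝ) * h N ^ (1 / (e:ℝ)) := by
      rw [← Real.rpow_add (hh N), hs, sub_add_cancel, Real.rpow_natCast]
    rw [hsplit] at hvol
    refine le_of_mul_le_mul_right ?_ hpos
    calc _ = _ := by ring
      _ ≤ _ := hvol
      _ = _ := by simp only [C0]; ring
  apply dimH_le_of_hausdorffMeasure_ne_top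
  have hmain := Measure.hausdorffMeasure_le_liminf_sum (ι := fun N => A N) (s : ℝ) S (l := atTop)
    (fun N : ℕ => ENNReal.ofReal (h N)) ?_ (fun N z => cell N z.1)
    (Eventually.of_forall fun N z => hdiam N z.1) (Eventually.of_forall fun N => ?_)
  · refine ne_top_of_le_ne_top (b := ENNReal.ofReal C0) ENNReal.ofReal_ne_top (hmain.trans ?_)
    have hb : ∀ N, ∑ z : A N, ediam (cell N z.1) ^ (s:ℝ) ≤ ENNReal.ofReal C0 := by
      intro N
      calc ∑ z : A N, ediam (cell N z.1) ^ (s:ℝ) ≤ ∑ z : A N, ENNReal.ofReal (h N) ^ (s:ℝ) := by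
            gcongr; exact hdiam _ _
        _ = (A N).card * ENNReal.ofReal (h N) ^ (s:ℝ) := by simp
        _ = ENNReal.ofReal ((A N).card * h N ^ (s:ℝ)) := by
            rw [ENNReal.ofReal_rpow_of_pos (hh N), ENNReal.ofReal_mul (by positivity),
              ENNReal.ofReal_natCast]
        _ ≤ _ := ENNReal.ofReal_le_ofReal (hcard N)
    calc _ ≤ liminf (fun _ : ℕ => ENNReal.ofReal C0) atTop := liminf_le_liminf (Eventually.of_forall hb)
      _ = _ := by simp
  · rw [← ENNReal.ofReal_zero]
    exact ENNReal.tendsto_ofReal tendsto_one_div_add_atTop_nhds_zero_nat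
  · intro x hx
    rw [Set.mem_iUnion]
    have hc : x ∈ cell N (fun i => ⌊x i * (N + 1)⌋) := by
      intro i _
      rw [Set.mem_Ico]
      have h1 := Int.floor_le (x i * ((N:ℝ) + 1))
      have h2 := Int.lt_floor_add_one (x i * ((N:ℝ) + 1))
      have e1 : x i = (x i * ((N:ℝ) + 1)) * h N := by rw [mul_assoc, mul_comm _ (h N), hhN, mul_one]
      constructor
      · conv_rhs => rw [e1]
        exact mul_le_mul_of_nonneg_right h1 (hh N).le
      · conv_lhs => rw [e1]
        exact mul_lt_mul_of_pos_right h2 (hh N)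
    refine ⟨⟨fun i => ⌊x i * (N + 1)⌋, Finset.mem_filter.mpr ⟨?_, x, hc, hx⟩⟩, hc⟩
    rw [Fintype.mem_piFinset]
    intro i
    have := norm_le_pi_norm x i
    rw [Real.norm_eq_abs] at this
    have := abs_le.mp (this.trans hx.2)
    rw [Finset.mem_Icc]
    have hN : (0:ℝ) < N + 1 := by positivity
    constructor
    · rw [Int.le_floor]; push_cast; nlinarith [this.1]
    · have : (⌊x i * ((N:ℝ) + 1)⌋ : ℝ) ≤ M * (N + 1) := (Int.floor_le _).trans (by nlinarith [this.2])
      exact_mod_cast this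

lemma dimH_zero_lt {m : ℕ} (Q : MvPolynomial (Fin (m+1)) ℝ) (e : ℕ)
    (hdeg : Q.totalDegree ≤ e) (hco : 1 ≤ |coeff (Finsupp.single 0 e) Q|) :
    dimH {x : EuclideanSpace ℝ (Fin (m+1)) | eval (fun i => x i) Q = 0} < ((m + 1 : ℕ) : ℝ≥0∞) := by
  rcases Nat.eq_zero_or_pos e with rfl | he
  · have hQ : Q = C (coeff 0 Q) := totalDegree_eq_zero_iff_eq_C.mp (by omega)
    rw [Finsupp.single_zero] at hco
    have : {x : EuclideanSpace ℝ (Fin (m+1)) | eval (fun i => x i) Q = 0} = ∅ := by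
      ext x
      simp only [Set.mem_ofPred_eq, Set.mem_empty_iff_false, iff_false]
      rw [hQ, eval_C]; intro h; rw [h] at hco; norm_num at hco
    rw [this, dimH_empty]
    exact_mod_cast Nat.succ_pos m
  · have h1e : 1 / (e:ℝ) ≤ 1 := by
      rw [div_le_one (by positivity)]; exact_mod_cast he
    have h1e' : 0 < 1 / (e:ℝ) := by positivity
    let s : ℝ≥0 := ⟨(m + 1 : ℕ) - 1 / (e : ℝ), by push_cast; linarith [(Nat.cast_nonneg m : (0:ℝ) ≤ m)]⟩
    have hs : (s : ℝ) = (m + 1 : ℕ) - 1 / (e : ℝ) := rfl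
    have hle : dimH {x : EuclideanSpace ℝ (Fin (m+1)) | eval (fun i => x i) Q = 0} ≤ s := by
      have hsub : {x : EuclideanSpace ℝ (Fin (m+1)) | eval (fun i => x i) Q = 0} ⊆
          (WithLp.toLp 2) '' (⋃ M : ℕ, {x : Fin (m+1) → ℝ | eval x Q = 0 ∧ ‖x‖ ≤ M}) := by
        intro x hx
        obtain ⟨M, hM⟩ := exists_nat_ge ‖x.ofLp‖
        exact ⟨x.ofLp, Set.mem_iUnion.mpr ⟨M, hx, hM⟩, rfl⟩
      refine (dimH_mono hsub).trans
        (((PiLp.lipschitzWith_toLp 2 (fun _ : Fin (m+1) => ℝ)).dimH_image_le _).trans ?_)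
      rw [dimH_iUnion]
      exact iSup_le fun M => dimH_bounded_zero_le Q e he hdeg hco M s hs
    refine hle.trans_lt ?_
    have : s < ((m + 1 : ℕ) : ℝ≥0) := by
      rw [← NNReal.coe_lt_coe, hs]; push_cast; linarith
    exact_mod_cast this

lemma separated_uniform {n : ℕ} (S : Fin n → Set (EuclideanSpace ℝ (Fin n)))
    (hsep : SeparatedAtInfinity S) (j0 : Fin n) :
    ∃ R : ℝ, 0 < R ∧ ∃ η : ℝ, 0 < η ∧ η ≤ 1 ∧ ∀ x : EuclideanSpace ℝ (Fin n), R ≤ ‖x‖ →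
      ∀ a : Fin n → EuclideanSpace ℝ (Fin n), (∀ j, a j ∈ S j) → (∀ j, ‖a j - x‖ ≤ η) →
        ∃ p ∈ ⋂ j, S j, dist x p < 2 := by
  by_contra! hcon
  have hc : ∀ l : ℕ, ∃ x : EuclideanSpace ℝ (Fin n), (l:ℝ) + 1 ≤ ‖x‖ ∧
      ∃ a : Fin n → EuclideanSpace ℝ (Fin n), (∀ j, a j ∈ S j) ∧
        (∀ j, ‖a j - x‖ ≤ 1 / ((l:ℝ) + 1)) ∧ ∀ p ∈ ⋂ j, S j, 2 ≤ dist x p := by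
    intro l
    refine hcon ((l:ℝ) + 1) (by positivity) (1 / ((l:ℝ) + 1)) (by positivity) ?_
    rw [div_le_one (by positivity)]; linarith [(Nat.cast_nonneg l : (0:ℝ) ≤ l)]
  choose x hx a haS hax hp using hc
  have h0 : Tendsto (fun l : ℕ => 1 / ((l:ℝ) + 1)) atTop (nhds 0) :=
    tendsto_one_div_add_atTop_nhds_zero_nat
  have h1l : ∀ l : ℕ, 1 / ((l:ℝ) + 1) ≤ 1 := fun l => by
    rw [div_le_one (by positivity)]; linarith [(Nat.cast_nonneg l : (0:ℝ) ≤ l)]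
  have hlim := hsep.2 (fun j l => a l j) (fun j l => haS l j) ?_ ?_ j0
  · have hev := hlim.eventually_lt_const (show (0:ℝ) < 1 by norm_num)
    obtain ⟨l, hl⟩ := hev.exists
    rw [infDist_lt_iff hsep.1] at hl
    obtain ⟨p, hpS, hpd⟩ := hl
    have h2 := hp l p hpS
    have h3 : dist (x l) p ≤ dist (x l) (a l j0) + dist (a l j0) p := dist_triangle _ _ _
    have h4 : dist (x l) (a l j0) ≤ 1 := by
      rw [dist_comm, dist_eq_norm]; exact (hax l j0).trans (h1l l)
    linarith
  · intro j
    refine tendsto_atTop_mono (fun l => ?_) (tendsto_natCast_atTop_atTop (R := ℝ))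
    have h2 : ‖x l‖ ≤ ‖a l j‖ + ‖a l j - x l‖ := by
      have := norm_sub_le (a l j) (a l j - x l); simpa using this
    linarith [hx l, hax l j, h1l l]
  · intro j i _
    have h2 : Tendsto (fun l : ℕ => 1 / ((l:ℝ) + 1) + 1 / ((l:ℝ) + 1)) atTop (nhds 0) := by
      simpa using h0.add h0
    refine squeeze_zero (fun l => norm_nonneg _) (fun l => ?_) h2
    have : a l j - a l i = (a l j - x l) - (a l i - x l) := by abel
    rw [this]
    exact (norm_sub_le _ _).trans (add_le_add (hax l j) (hax l i))

lemma euclid_box_volume {m : ℕ} (P : MvPolynomial (Fin (m+1)) ℝ) (e : ℕ) (he : 1 ≤ e)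
    (hdeg : P.totalDegree ≤ e) (hco : 1 ≤ |coeff (Finsupp.single 0 e) P|)
    (δ : ℝ) (hδ : 0 < δ) (a : Fin (m+1) → ℝ) (L : ℝ) (hL : 0 ≤ L) :
    volume {x : EuclideanSpace ℝ (Fin (m+1)) | |eval (fun i => x i) P| ≤ δ ∧
      ∀ i, x i ∈ Set.Icc (a i) (a i + L)} ≤
      ENNReal.ofReal (L ^ m * (2 * e * δ ^ (1 / (e : ℝ)))) := by
  have h := box_sublevel_volume P e he hdeg hco δ hδ a L hL
  have hmp := EuclideanSpace.volume_preserving_symm_measurableEquiv_toLp (Fin (m+1))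
  rw [← hmp.measure_preimage_equiv] at h
  exact h

lemma near_critical {n : ℕ} (P : MvPolynomial (Fin n) ℝ) (d : ℕ) (hd : 1 ≤ d)
    (hdP : P.totalDegree ≤ d) (hmonic : ∀ i : Fin n, coeff (Finsupp.single i d) P = 1)
    (hsign : (∀ x : EuclideanSpace ℝ (Fin n), 0 ≤ eval (fun i => x i) P) ∨
      (∀ x : EuclideanSpace ℝ (Fin n), eval (fun i => x i) P ≤ 0))
    (η δ : ℝ) (hη : 0 < η) (hδ : 0 < δ) (hsmall : 2 * d * δ ^ (1 / (d:ℝ)) < η)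
    (x : EuclideanSpace ℝ (Fin n)) (hx : |eval (fun i => x i) P| ≤ δ) (i : Fin n) :
    ∃ a : EuclideanSpace ℝ (Fin n), eval (fun j => a j) (pderiv i P) = 0 ∧ ‖a - x‖ ≤ η := by
  set q := slicePoly P i x.ofLp with hq
  have hc := slicePoly_coeff P i x.ofLp d hdP
  rw [hmonic i, ← hq] at hc
  have hdeg : q.natDegree = d := le_antisymm (slicePoly_natDegree_le P i _ d hdP)
    (Polynomial.le_natDegree_of_ne_zero (by rw [hc]; exact one_ne_zero))
  have hlead : q.leadingCoeff = 1 := by rw [Polynomial.leadingCoeff, hdeg, hc]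
  have hvol : volume {t : ℝ | |q.eval t| ≤ δ} < ENNReal.ofReal η :=
    (poly_sublevel_volume q d hd hdeg (by rw [hlead]; simp) δ hδ).trans_lt
      ((ENNReal.ofReal_lt_ofReal_iff hη).mpr hsmall)
  have hqx : q.eval (x i) = eval (fun i => x i) P := by
    rw [hq, slicePoly_eval, Function.update_eq_self]
  have hcrit : ∃ y, |y - x i| ≤ η ∧ q.derivative.eval y = 0 := by
    rcases hsign with h | h
    · refine exists_critical q (fun t => ?_) δ η (x i) hvol ?_
      · rw [hq, slicePoly_eval]; exact h (WithLp.toLp 2 (Function.update x.ofLp i t))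
      · rw [hqx]; exact (le_abs_self _).trans hx
    · have hpos : ∀ t, 0 ≤ (-q).eval t := by
        intro t
        have h0 : q.eval t ≤ 0 := by
          rw [hq, slicePoly_eval]
          exact h (WithLp.toLp 2 (Function.update x.ofLp i t))
        rw [Polynomial.eval_neg]
        linarith
      have hle : (-q).eval (x i) ≤ δ := by
        rw [Polynomial.eval_neg, hqx]; exact (neg_le_abs _).trans hx
      obtain ⟨y, hy1, hy2⟩ := exists_critical (-q) hpos δ η (x i) (by simpa using hvol) hle
      exact ⟨y, hy1, by simpa using hy2⟩
  obtain ⟨y, hy1, hy2⟩ := hcrit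
  refine ⟨WithLp.toLp 2 (Function.update x.ofLp i y), ?_, ?_⟩
  · rw [hq, slicePoly_derivative, slicePoly_eval] at hy2
    exact hy2
  · have : WithLp.toLp 2 (Function.update x.ofLp i y) - x = EuclideanSpace.single i (y - x i) := by
      ext j
      by_cases h : j = i
      · subst h; simp
      · simp [h]
    rw [this, EuclideanSpace.norm_single]
    exact hy1

lemma coeff_pderiv_top {n : ℕ} (P : MvPolynomial (Fin n) ℝ) (d : ℕ) (hd : 1 ≤ d)
    (hdP : P.totalDegree ≤ d) (i : Fin n) :
    coeff (Finsupp.single i (d - 1)) (pderiv i P) = d * coeff (Finsupp.single i d) P := by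
  have h1 := slicePoly_coeff (pderiv i P) i 0 (d - 1) (totalDegree_pderiv_le P i d hdP)
  have h2 := slicePoly_coeff P i 0 d hdP
  rw [← h1, ← h2, ← slicePoly_derivative, Polynomial.coeff_derivative]
  obtain ⟨d, rfl⟩ : ∃ c, d = c + 1 := ⟨d - 1, by omega⟩
  simp; ring

theorem statement7 (n : ℕ) (P : MvPolynomial (Fin n) ℝ) (d : ℕ) (hdP : P.totalDegree = d)
    (k : ℕ) (hk : dimH {x : EuclideanSpace ℝ (Fin n) | eval (fun i => x i) P = 0} = (k : ℝ≥0∞))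
    (hkn : k + 1 < n)
    (hmonic : ∀ i : Fin n, coeff (Finsupp.single i d) P = 1)
    (hsep : SeparatedAtInfinity (fun i : Fin n =>
      {x : EuclideanSpace ℝ (Fin n) | eval (fun j => x j) (pderiv i P) = 0}))
    (k' : ℕ)
    (hk' : dimH (⋂ i : Fin n,
        {x : EuclideanSpace ℝ (Fin n) | eval (fun j => x j) (pderiv i P) = 0}) = (k' : ℝ≥0∞)) :
    ∃ ν : ℝ, 0 < ν ∧ ∃ C : ℝ, 0 < C ∧ ∃ δ₁ : ℝ, 0 < δ₁ ∧
      ∀ r : ℝ, 0 < r → ∀ δ : ℝ, 0 < δ → δ < δ₁ →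
        volume (sublevel P δ ∩ cube n r) ≤ ENNReal.ofReal (C * r ^ k' * δ ^ ν) := by
  classical
  obtain ⟨m, rfl⟩ : ∃ m, n = m + 1 := ⟨n - 1, by omega⟩
  rcases Nat.eq_zero_or_pos d with rfl | hd
  · -- constant case
    have hP : P = C (coeff 0 P) := totalDegree_eq_zero_iff_eq_C.mp hdP
    have h1 := hmonic 0
    rw [Finsupp.single_zero] at h1
    rw [h1] at hP
    refine ⟨1, one_pos, 1, one_pos, 1, one_pos, fun r hr δ hδ hδ1 => ?_⟩
    have : sublevel P δ = ∅ := by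
      ext x
      simp only [sublevel, Set.mem_ofPred_eq, Set.mem_empty_iff_false, iff_false, not_le]
      rw [hP]; simpa using hδ1
    rw [this]; simp
  have hsign := const_sign P hk hkn
  set Z' := ⋂ i : Fin (m+1),
    {x : EuclideanSpace ℝ (Fin (m+1)) | eval (fun j => x j) (pderiv i P) = 0} with hZ'
  have hd1 : (1:ℝ) ≤ d := by exact_mod_cast hd
  have hdeg : P.totalDegree ≤ d := hdP.le
  have hco : 1 ≤ |coeff (Finsupp.single 0 d) P| := by rw [hmonic 0]; simp
  -- the dimension of the critical set is at most m
  have hk'm : k' ≤ m := by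
    have h1 : dimH Z' < ((m + 1 : ℕ) : ℝ≥0∞) := by
      refine (dimH_mono (Set.iInter_subset _ 0)).trans_lt
        (dimH_zero_lt (pderiv 0 P) (d - 1) (totalDegree_pderiv_le P 0 d hdeg) ?_)
      rw [coeff_pderiv_top P d hd hdeg, hmonic 0, mul_one, abs_of_nonneg (by positivity)]
      exact hd1
    rw [hk'] at h1
    have : k' < m + 1 := by exact_mod_cast h1
    omega
  -- generic grid
  obtain ⟨t, ht⟩ := exists_generic (s := k') Z' (by rw [hk']; exact_mod_cast Nat.lt_succ_self k')
  let f : MvPolynomial (Fin (m+1)) ℝ := ∑ i, (pderiv i P) ^ 2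
  have hfeval : ∀ x, eval x f = ∑ i, (eval x (pderiv i P)) ^ 2 := by intro x; simp [f]
  have hf : ∀ x, 0 ≤ eval x f := fun x => by
    rw [hfeval]; exact Finset.sum_nonneg fun i _ => sq_nonneg _
  have hf0 : ∀ x : EuclideanSpace ℝ (Fin (m+1)), eval x.ofLp f = 0 ↔ x ∈ Z' := by
    intro x
    rw [hfeval, Finset.sum_eq_zero_iff_of_nonneg (fun i _ => sq_nonneg _)]
    simp [hZ']
  have hfdeg : f.totalDegree < 2 * (d + 2) := by
    refine lt_of_le_of_lt (totalDegree_finsetSum_le (d := 2 * d) fun i _ => ?_) (by omega)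
    refine (totalDegree_pow _ _).trans ?_
    have := totalDegree_pderiv_le P i d hdeg
    gcongr; omega
  obtain ⟨R, hR, η, hη, hη1, hsepu⟩ := separated_uniform _ hsep 0
  obtain ⟨T, hT⟩ := exists_nat_ge ‖t‖
  have htT : ∀ i, |t i| ≤ T := fun i => (norm_le_pi_norm t i).trans hT
  let B0 : ℕ := (2 * (d + 2) - 1) ^ (m+1) * (2 ^ (m+1) * 2 ^ (m+1))
  let C1 : ℝ := 2 ^ m + (2 * R) ^ m + 5 ^ m * (B0 * (2 * T + 15) ^ k')
  have hC1 : 0 < C1 := by positivity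
  refine ⟨1 / (d:ℝ), by positivity, C1 * (2 * d), by positivity, (η / (2 * d)) ^ d, by positivity,
    fun r hr δ hδ hδ1 => ?_⟩
  set β : ℝ := 2 * d * δ ^ (1 / (d:ℝ)) with hβ
  have hβ0 : 0 ≤ β := by positivity
  have hsmall : β < η := by
    have h1 : δ ^ (1 / (d:ℝ)) < η / (2 * d) := by
      calc δ ^ (1 / (d:ℝ)) < ((η / (2 * d)) ^ d) ^ (1 / (d:ℝ)) :=
            Real.rpow_lt_rpow hδ.le hδ1 (by positivity)
        _ = η / (2 * d) := by
            rw [one_div, Real.pow_rpow_inv_natCast (by positivity) (by omega)]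
    rw [lt_div_iff₀ (by positivity)] at h1
    rw [hβ]; linarith
  have hgoal : C1 * (2 * d) * r ^ k' * δ ^ (1 / (d:ℝ)) = C1 * r ^ k' * β := by rw [hβ]; ring
  rw [hgoal]
  have hbox := fun a L hL => euclid_box_volume P d hd hdeg hco δ hδ a L hL
  rw [← hβ] at hbox
  rcases lt_or_ge r 1 with hr1 | hr1
  · -- small cubes
    have hsub : sublevel P δ ∩ cube (m+1) r ⊆ {x : EuclideanSpace ℝ (Fin (m+1)) |
        |eval (fun i => x i) P| ≤ δ ∧ ∀ i, x i ∈ Set.Icc (-r) (-r + 2 * r)} := by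
      rintro x ⟨hx1, hx2⟩
      refine ⟨hx1, fun i => ?_⟩
      have := hx2 i
      constructor <;> linarith [this.1, this.2]
    refine (measure_mono hsub).trans ((hbox (fun _ => -r) (2 * r) (by positivity)).trans ?_)
    apply ENNReal.ofReal_le_ofReal
    apply mul_le_mul_of_nonneg_right _ hβ0
    rw [mul_pow]
    have h1 : r ^ m ≤ r ^ k' := pow_le_pow_of_le_one hr.le hr1.le hk'm
    have h2 : (2:ℝ) ^ m ≤ C1 := by
      simp only [C1]; rw [add_assoc]; exact le_add_of_nonneg_right (by positivity)
    exact mul_le_mul h2 h1 (by positivity) hC1.le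
  · -- large cubes
    let K : ℕ := ⌈r⌉₊ + T + 4
    have hK1 : r + T + 4 ≤ K := by
      simp only [K]; push_cast; linarith [Nat.le_ceil r]
    have hK2 : (K:ℝ) ≤ r + T + 5 := by
      simp only [K]; push_cast; linarith [Nat.ceil_lt_add_one hr.le]
    let A : Finset (Fin (m+1) → ℤ) := (Fintype.piFinset fun _ => Finset.Icc (-(K:ℤ)) K).filter
      (fun z => ∃ x, eval x f = 0 ∧ ∀ i, x i ∈ Set.Icc (t i + z i) (t i + z i + 1))
    have hA : A.card ≤ B0 * (2 * K + 3) ^ k' := by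
      have := card_cubes_le (e := d + 2) (s := k') (by omega) f hfdeg hf t
        (fun x hx I hI => ht (WithLp.toLp 2 x) ((hf0 _).mp hx) I hI) K A
        (fun z hz i => by
          have := Fintype.mem_piFinset.mp (Finset.mem_filter.mp hz).1 i
          rw [abs_le]; exact Finset.mem_Icc.mp this)
        (fun z hz => (Finset.mem_filter.mp hz).2)
      refine this.trans (le_of_eq ?_)
      simp only [B0]; ring
    have hA' : (A.card : ℝ) ≤ B0 * ((2 * T + 15) ^ k' * r ^ k') := by
      calc (A.card : ℝ) ≤ ((B0 * (2 * K + 3) ^ k' : ℕ) : ℝ) := by exact_mod_cast hA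
        _ = B0 * (2 * K + 3) ^ k' := by push_cast; ring
        _ ≤ B0 * ((2 * T + 15) ^ k' * r ^ k') := by
          rw [← mul_pow]
          gcongr
          have hT0 : (0:ℝ) ≤ T := Nat.cast_nonneg T
          nlinarith
    let box : (Fin (m+1) → ℝ) → ℝ → Set (EuclideanSpace ℝ (Fin (m+1))) := fun a L =>
      {x | |eval (fun i => x i) P| ≤ δ ∧ ∀ i, x i ∈ Set.Icc (a i) (a i + L)}
    have hsub : sublevel P δ ∩ cube (m+1) r ⊆ box (fun _ => -R) (2 * R) ∪
        ⋃ z ∈ A, box (fun i => t i + z i - 2) 5 := by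
      rintro x ⟨hx1, hx2⟩
      rcases lt_or_ge ‖x‖ R with hxR | hxR
      · left
        refine ⟨hx1, fun i => ?_⟩
        have h1 := PiLp.norm_apply_le x i
        rw [Real.norm_eq_abs] at h1
        have := abs_le.mp (h1.trans hxR.le)
        constructor <;> linarith [this.1, this.2]
      · right
        choose a ha1 ha2 using near_critical P d hd hdeg hmonic hsign η δ hη hδ hsmall x hx1
        obtain ⟨p, hpZ, hxp⟩ := hsepu x hxR a ha1 ha2
        have hpi : ∀ i, |x i - p i| < 2 := fun i => by
          rw [dist_eq_norm] at hxp
          have := PiLp.norm_apply_le (x - p) i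
          rw [Real.norm_eq_abs] at this
          exact lt_of_le_of_lt this hxp
        have hfl1 : ∀ i, (⌊p i - t i⌋ : ℝ) ≤ p i - t i := fun i => Int.floor_le _
        have hfl2 : ∀ i, p i - t i < ⌊p i - t i⌋ + 1 := fun i => Int.lt_floor_add_one _
        simp only [Set.mem_iUnion]
        refine ⟨fun i => ⌊p i - t i⌋, Finset.mem_filter.mpr ⟨?_, p.ofLp, (hf0 p).mpr hpZ, ?_⟩,
          hx1, ?_⟩
        · rw [Fintype.mem_piFinset]
          intro i
          have h1 := abs_lt.mp (hpi i)
          have h2 := abs_le.mp (htT i)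
          have h3 := hx2 i
          rw [Set.mem_Ioo] at h3
          rw [Finset.mem_Icc]
          constructor
          · rw [Int.le_floor]; push_cast; linarith [h1.1, h1.2, h2.1, h2.2, h3.1, h3.2]
          · have : (⌊p i - t i⌋ : ℝ) ≤ (K:ℝ) := by
              linarith [hfl1 i, h1.1, h1.2, h2.1, h2.2, h3.1, h3.2]
            exact_mod_cast this
        · intro i
          constructor <;> linarith [hfl1 i, hfl2 i]
        · intro i
          have h1 := abs_lt.mp (hpi i)
          constructor <;> linarith [hfl1 i, hfl2 i, h1.1, h1.2]
    calc volume (sublevel P δ ∩ cube (m+1) r)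
        ≤ volume (box (fun _ => -R) (2 * R)) +
          ∑ z ∈ A, volume (box (fun i => t i + z i - 2) 5) :=
          (measure_mono hsub).trans ((measure_union_le _ _).trans
            (add_le_add le_rfl (measure_biUnion_finset_le _ _)))
      _ ≤ ENNReal.ofReal ((2 * R) ^ m * β) + ∑ z ∈ A, ENNReal.ofReal (5 ^ m * β) :=
          add_le_add (hbox _ _ (by positivity))
            (Finset.sum_le_sum fun z _ => hbox _ _ (by norm_num))
      _ = ENNReal.ofReal ((2 * R) ^ m * β + A.card * (5 ^ m * β)) := by
          rw [Finset.sum_const, nsmul_eq_mul, ENNReal.ofReal_add (by positivity) (by positivity),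
            ENNReal.ofReal_mul (p := (A.card : ℝ)) (by positivity), ENNReal.ofReal_natCast]
      _ ≤ ENNReal.ofReal (C1 * r ^ k' * β) := by
          apply ENNReal.ofReal_le_ofReal
          have hrk : 1 ≤ r ^ k' := one_le_pow₀ hr1
          have h1 : (2 * R) ^ m * β ≤ (2 * R) ^ m * r ^ k' * β := by
            gcongr; exact le_mul_of_one_le_right (by positivity) hrk
          have h2 : A.card * (5 ^ m * β) ≤ B0 * ((2 * T + 15) ^ k' * r ^ k') * (5 ^ m * β) := by
            gcongr
          have h3 : 0 ≤ (2:ℝ) ^ m * r ^ k' * β := by positivity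
          calc _ ≤ 2 ^ m * r ^ k' * β + (2 * R) ^ m * r ^ k' * β +
                B0 * ((2 * T + 15) ^ k' * r ^ k') * (5 ^ m * β) := by linarith
            _ = _ := by simp only [C1]; ring
end

section
/- Let n ≥ 2 and let P be a real polynomial on ℝ^n with P(0) = 0. Define P_1 := P and P_m(x) := det(∂P_i/∂x_j)_{1 ≤ i,j ≤ m−1} for 2 ≤ m ≤ n+1, and assume deg P_{l+1} ≥ 1 for some 1 ≤ l ≤ n. Let α be an admissible index for P_{l+1}, and set θ := (1 − 2^{l−1})/(2^{l−1} + |α|) and τ := 2^{l−1}/(2^{l−1} + |α|). Then for every μ ∈ (0, τ) there exists a constant C > 0, depending only on the coefficients of P_1, …, P_{l+1} and on α, such that for all r > 0, ∫_{Δ_r^n} |P(x)|^{−μ} dλ_n(x) ≤ C·[r^{n − μ(|α|+1)/|α|} + r^{n + θ − τ/μ}]. In particular the integration index satisfies i(P) ≥ τ. -/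
open MeasureTheory Metric MvPolynomial
open scoped ENNReal NNReal

/-- `α` is an admissible index (i.e. `x^α` is an admissible monomial) for the real
polynomial `P` on `ℝ^n`. -/
def IsAdmissibleIndex {n : ℕ} (P : MvPolynomial (Fin n) ℝ) (α : Fin n →₀ ℕ) : Prop :=
  MvPolynomial.coeff α P ≠ 0 ∧
  ∃ σ : Equiv.Perm (Fin n),
    (∃ h : 0 < n, 1 ≤ α (σ ⟨0, h⟩)) ∧
    ∀ β : Fin n →₀ ℕ, β ≠ α → MvPolynomial.coeff β P ≠ 0 →
      ∃ j : Fin n, β (σ j) < α (σ j) ∧ ∀ k : Fin n, k < j → α (σ k) = β (σ k)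

/-- The sequence `P_1 = P`, `P_m = det (∂P_i/∂x_j)_{1 ≤ i,j ≤ m-1}` for `2 ≤ m ≤ n+1`. -/
noncomputable def Pseq {n : ℕ} (P : MvPolynomial (Fin n) ℝ) : ℕ → MvPolynomial (Fin n) ℝ
  | 0 => 0
  | 1 => P
  | m + 2 =>
    if h : m + 1 ≤ n then
      Matrix.det (Matrix.of fun i j : Fin (m + 1) =>
        MvPolynomial.pderiv (Fin.castLE h j) (Pseq P ((i : ℕ) + 1)))
    else 0
  termination_by m => m
  decreasing_by omega


lemma cons_eq_pi {n : ℕ} (t : ℝ) (y : Fin n → ℝ) :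
    (MeasurableEquiv.piFinSuccAbove (fun _ : Fin (n+1) => ℝ) 0).symm (t, y) = Fin.cons t y := by
  rw [← Fin.insertNth_zero']; rfl

lemma slice_eq {n : ℕ} (s : Set (Fin (n+1) → ℝ)) (y : Fin n → ℝ) :
    (fun x : ℝ => (x, y)) ⁻¹' ((MeasurableEquiv.piFinSuccAbove (fun _ : Fin (n+1) => ℝ) 0).symm ⁻¹' s) =
      {t : ℝ | (Fin.cons t y : Fin (n+1) → ℝ) ∈ s} := by
  ext t
  simp only [Set.mem_preimage, cons_eq_pi]
  rfl

lemma vol_fin_succ {n : ℕ} (s : Set (Fin (n+1) → ℝ)) (hs : MeasurableSet s) :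
    volume s = ∫⁻ y : Fin n → ℝ, volume {t : ℝ | (Fin.cons t y : Fin (n+1) → ℝ) ∈ s} := by
  have h := (volume_preserving_piFinSuccAbove (fun _ : Fin (n+1) => ℝ) 0).symm
  rw [← h.measure_preimage hs.nullMeasurableSet, Measure.volume_eq_prod, Measure.prod_apply_symm
    (h.measurable hs)]
  refine lintegral_congr fun y => ?_
  rw [slice_eq]

lemma meas_eval {n : ℕ} (p : MvPolynomial (Fin n) ℝ) : Measurable fun x : Fin n → ℝ => eval x p :=
  (MvPolynomial.continuous_eval p).measurable

lemma ae_eval_ne_zero : ∀ {n : ℕ} (p : MvPolynomial (Fin n) ℝ), p ≠ 0 →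
    ∀ᵐ x : Fin n → ℝ, eval x p ≠ 0
  | 0, p, hp => by
    refine Filter.Eventually.of_forall fun x => ?_
    rw [MvPolynomial.eq_C_of_isEmpty p] at hp ⊢
    simpa using hp
  | n+1, p, hp => by
    have hms : MeasurableSet {x : Fin (n+1) → ℝ | eval x p = 0} :=
      meas_eval p (measurableSet_singleton 0)
    have hq : (finSuccEquiv ℝ n p) ≠ 0 := by simpa using hp
    have ih := ae_eval_ne_zero _ (Polynomial.leadingCoeff_ne_zero.2 hq)
    rw [ae_iff]
    simp only [not_not]
    rw [vol_fin_succ _ hms, lintegral_eq_zero_iff' ]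
    · filter_upwards [ih] with y hy
      simp only [MvPolynomial.eval_eq_eval_mv_eval']
      apply Set.Finite.measure_zero
      have : Polynomial.map (eval y) (finSuccEquiv ℝ n p) ≠ 0 := by
        intro h0
        apply hy
        have := congrArg (fun q => Polynomial.coeff q (finSuccEquiv ℝ n p).natDegree) h0
        simpa [Polynomial.coeff_map] using this
      refine (Polynomial.finite_setOfPred_isRoot this).subset ?_
      intro t ht; exact ht
    · have h := (volume_preserving_piFinSuccAbove (fun _ : Fin (n+1) => ℝ) 0).symm
      have h2 := (measurable_measure_prodMk_right (μ := (volume : Measure ℝ)) (h.measurable hms))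
      simp only [slice_eq] at h2
      exact h2.aemeasurable

lemma fiber_bound {n : ℕ} (f : Fin n → MvPolynomial (Fin n) ℝ) :
    ∃ N : ℕ, ∀ᵐ y : Fin n → ℝ, {x : Fin n → ℝ | ∀ i, eval x (f i) = y i}.encard ≤ N := by
  have key : ∀ j : Fin n, ∃ H : Polynomial (MvPolynomial (Fin n) ℝ), H ≠ 0 ∧
      ∀ x : Fin n → ℝ, Polynomial.eval (x j) (Polynomial.map (eval (fun i => eval x (f i))) H) = 0 := by
    intro j
    let g : Option (Fin n) → MvPolynomial (Fin n) ℝ := fun o => o.elim (X j) f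
    have hg : ¬ AlgebraicIndependent ℝ g := by
      intro h
      have := h.lift_cardinalMk_le_trdeg
      rw [MvPolynomial.trdeg_of_isDomain] at this
      simp only [Cardinal.mk_fintype, Fintype.card_option, Fintype.card_fin, Cardinal.lift_natCast] at this
      have h2 := Nat.cast_le.1 this
      omega
    rw [algebraicIndependent_iff] at hg
    push Not at hg
    obtain ⟨G, hG0, hG⟩ := hg
    refine ⟨optionEquivLeft ℝ _ G, by simpa using hG, fun x => ?_⟩
    rw [← optionEquivLeft_elim_eval]
    have := congrArg (eval x) hG0
    rw [map_zero] at this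
    rw [← this, MvPolynomial.aeval_def, ← MvPolynomial.eval₂_id, MvPolynomial.eval₂_comp_left (MvPolynomial.eval x)]
    rw [MvPolynomial.eval₂_id, MvPolynomial.eval]
    simp only [coe_eval₂Hom]
    congr 1
    · ext; simp
    · ext o; cases o <;> simp [g]
  choose H hH0 hH using key
  refine ⟨∏ j, (H j).natDegree, ?_⟩
  have hae : ∀ᵐ y : Fin n → ℝ, ∀ j, eval y (H j).leadingCoeff ≠ 0 :=
    ae_all_iff.2 fun j => ae_eval_ne_zero _ (Polynomial.leadingCoeff_ne_zero.2 (hH0 j))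
  filter_upwards [hae] with y hy
  have hne : ∀ j, Polynomial.map (eval y) (H j) ≠ 0 := by
    intro j h0
    apply hy j
    have := congrArg (fun q => Polynomial.coeff q (H j).natDegree) h0
    simpa [Polynomial.coeff_map] using this
  classical
  have hsub : {x : Fin n → ℝ | ∀ i, eval x (f i) = y i} ⊆
      ((Fintype.piFinset fun j => (Polynomial.map (eval y) (H j)).roots.toFinset :
        Finset (Fin n → ℝ)) : Set (Fin n → ℝ)) := by
    intro x hx
    simp only [Finset.mem_coe, Fintype.mem_piFinset, Multiset.mem_toFinset]
    intro j
    rw [Polynomial.mem_roots (hne j)]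
    have := hH j x
    rwa [show (fun i => eval x (f i)) = y from funext hx] at this
  refine (Set.encard_le_encard hsub).trans ?_
  rw [Set.encard_coe_eq_coe_finsetCard, Fintype.card_piFinset]
  refine Nat.cast_le.2 (Finset.prod_le_prod' fun j _ => ?_)
  exact (Multiset.toFinset_card_le _).trans ((Polynomial.card_roots' _).trans
    Polynomial.natDegree_map_le)

lemma hasFDerivAt_eval {n : ℕ} (p : MvPolynomial (Fin n) ℝ) (x : Fin n → ℝ) :
    HasFDerivAt (fun x : Fin n → ℝ => eval x p)
      (∑ j, eval x (pderiv j p) • (ContinuousLinearMap.proj j : (Fin n → ℝ) →L[ℝ] ℝ)) x := by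
  induction p using MvPolynomial.induction_on with
  | C a => simpa using hasFDerivAt_const a x
  | add p q hp hq =>
    simp only [map_add, add_smul, Finset.sum_add_distrib]
    exact hp.add hq
  | mul_X p i hp =>
    have h1 : HasFDerivAt (fun x : Fin n → ℝ => x i) (ContinuousLinearMap.proj i : (Fin n → ℝ) →L[ℝ] ℝ) x :=
      hasFDerivAt_apply i x
    have := hp.mul h1
    simp only [map_mul, eval_X]
    refine this.congr_fderiv ?_
    ext v
    simp only [Derivation.leibniz, pderiv_X, smul_eq_mul, map_add, map_mul, eval_X, add_smul, Finset.sum_add_distrib]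
    simp [Finset.mul_sum, mul_assoc, Pi.single_apply, apply_ite]

/-- The Jacobian of a polynomial map. -/
noncomputable def jac {n : ℕ} (f : Fin n → MvPolynomial (Fin n) ℝ) : Matrix (Fin n) (Fin n) (MvPolynomial (Fin n) ℝ) :=
  Matrix.of fun i j => pderiv j (f i)

lemma area_bound {n : ℕ} (f : Fin n → MvPolynomial (Fin n) ℝ) :
    ∃ N : ℕ, ∀ E : Set (Fin n → ℝ), MeasurableSet E → (∀ x ∈ E, eval x (jac f).det ≠ 0) →
      ∀ B : Set (Fin n → ℝ), (∀ x ∈ E, (fun i => eval x (f i)) ∈ B) →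
      ∫⁻ x in E, ENNReal.ofReal |eval x (jac f).det| ≤ N * volume B := by
  obtain ⟨N, hN⟩ := fiber_bound f
  refine ⟨N, fun E hE hdet B hB => ?_⟩
  let F : (Fin n → ℝ) → (Fin n → ℝ) := fun x i => eval x (f i)
  let F' : (Fin n → ℝ) → ((Fin n → ℝ) →L[ℝ] (Fin n → ℝ)) := fun x =>
    ContinuousLinearMap.pi fun i => ∑ j, eval x (pderiv j (f i)) • (ContinuousLinearMap.proj j : (Fin n → ℝ) →L[ℝ] ℝ)
  have hF : ∀ x, HasFDerivAt F (F' x) x := fun x => hasFDerivAt_pi.2 fun i => hasFDerivAt_eval (f i) x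
  have hdetF : ∀ x, (F' x).det = eval x (jac f).det := by
    intro x
    have : ((F' x : (Fin n → ℝ) →L[ℝ] (Fin n → ℝ)) : (Fin n → ℝ) →ₗ[ℝ] (Fin n → ℝ)) =
        Matrix.toLin' ((eval x).mapMatrix (jac f)) := by
      apply LinearMap.ext; intro v; ext i
      simp [F', jac, Matrix.mulVec, dotProduct]
    rw [ContinuousLinearMap.det, this, LinearMap.det_toLin', RingHom.map_det]
  have hcd : ContDiff ℝ 1 F := by
    rw [contDiff_pi]
    intro i
    have := (AnalyticOnNhd.eval_mvPolynomial (𝕜 := ℝ) (f i))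
    exact this.contDiff
  have hloc : ∀ x ∈ E, ∃ U ∈ nhds x, IsOpen U ∧ Set.InjOn F U := by
    intro x hx
    have hs : HasStrictFDerivAt F (F' x) x :=
      hcd.contDiffAt.hasStrictFDerivAt' (hF x) (by norm_num)
    have hd : (F' x).det ≠ 0 := by rw [hdetF]; exact hdet x hx
    let e := (F' x).toContinuousLinearEquivOfDetNeZero hd
    have hs' : HasStrictFDerivAt F (e : (Fin n → ℝ) →L[ℝ] (Fin n → ℝ)) x := by
      simpa [e] using hs
    exact ⟨(hs'.toOpenPartialHomeomorph F).source, (hs'.toOpenPartialHomeomorph F).open_source.mem_nhds hs'.mem_toOpenPartialHomeomorph_source, (hs'.toOpenPartialHomeomorph F).open_source,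
      by simpa using (hs'.toOpenPartialHomeomorph F).injOn⟩
  choose! U hU hUo hUi using hloc
  obtain ⟨t, htE, htc, htU⟩ := TopologicalSpace.countable_cover_nhdsWithin
    (fun x hx => mem_nhdsWithin_of_mem_nhds (hU x hx))
  by_cases hne : t.Nonempty
  swap
  · rw [Set.not_nonempty_iff_eq_empty] at hne
    subst hne
    have : E = ∅ := by simpa using htU
    simp [this]
  obtain ⟨s, rfl⟩ := htc.exists_eq_range hne
  let A : ℕ → Set (Fin n → ℝ) := disjointed fun k => E ∩ U (s k)
  have hAm : ∀ k, MeasurableSet (A k) := MeasurableSet.disjointed fun k => hE.inter (hUo _ (htE ⟨k, rfl⟩)).measurableSet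
  have hAsub : ∀ k, A k ⊆ E ∩ U (s k) := fun k => disjointed_subset _ k
  have hAd : Pairwise (Function.onFun Disjoint A) := disjoint_disjointed _
  have hAU : ⋃ k, A k = E := by
    rw [iUnion_disjointed, ← Set.inter_iUnion]
    apply Set.inter_eq_left.2
    simpa using htU
  have hinj : ∀ k, Set.InjOn F (A k) := fun k => (hUi _ (htE ⟨k, rfl⟩)).mono fun x hx => (hAsub k hx).2
  have hIm : ∀ k, MeasurableSet (F '' A k) := fun k =>
    measurable_image_of_fderivWithin (hAm k) (fun x _ => (hF x).hasFDerivWithinAt) (hinj k)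
  calc ∫⁻ x in E, ENNReal.ofReal |eval x (jac f).det|
      = ∑' k, ∫⁻ x in A k, ENNReal.ofReal |(F' x).det| := by
        rw [← hAU, lintegral_iUnion hAm hAd]
        simp only [hdetF]
    _ = ∑' k, volume (F '' A k) := by
        congr 1; ext k
        exact lintegral_abs_det_fderiv_eq_addHaar_image _ (hAm k) (fun x _ => (hF x).hasFDerivWithinAt) (hinj k)
    _ = ∫⁻ y, ∑' k, (F '' A k).indicator 1 y := by
        rw [lintegral_tsum fun k => (measurable_one.indicator (hIm k)).aemeasurable]
        congr 1; ext k
        rw [lintegral_indicator_one (hIm k)]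
    _ ≤ ∫⁻ y, (toMeasurable volume B).indicator (fun _ => (N : ℝ≥0∞)) y := by
        apply lintegral_mono_ae
        filter_upwards [hN] with y hy
        by_cases hyB : y ∈ toMeasurable volume B
        · rw [Set.indicator_of_mem hyB]
          refine ENNReal.summable.tsum_le_of_sum_le fun S => ?_
          classical
          have h1 : ∑ k ∈ S, (F '' A k).indicator (1 : (Fin n → ℝ) → ℝ≥0∞) y =
              ((S.filter fun k => y ∈ F '' A k).card : ℝ≥0∞) := by
            simp [Set.indicator_apply, Finset.sum_boole]
          rw [h1]
          have : ∀ k ∈ S.filter (fun k => y ∈ F '' A k), ∃ x ∈ A k, F x = y := by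
            intro k hk; exact (Finset.mem_filter.1 hk).2
          choose! g hg1 hg2 using this
          have hgi : Set.InjOn g (S.filter fun k => y ∈ F '' A k) := by
            intro a ha b hb hab
            by_contra hne
            exact (Set.disjoint_left.1 (hAd hne)) (hg1 a ha) (hab ▸ hg1 b hb)
          have h2 : ((S.filter fun k => y ∈ F '' A k).image g : Set (Fin n → ℝ)) ⊆ {x | ∀ i, eval x (f i) = y i} := by
            intro x hx
            simp only [Finset.coe_image] at hx
            obtain ⟨k, hk, rfl⟩ := hx
            intro i
            exact congrFun (hg2 k hk) i
          have h3 := (Set.encard_le_encard h2).trans hy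
          rw [Set.encard_coe_eq_coe_finsetCard, Finset.card_image_of_injOn hgi] at h3
          exact_mod_cast h3
        · rw [Set.indicator_of_notMem hyB]
          refine le_of_eq (ENNReal.tsum_eq_zero.2 fun k => Set.indicator_of_notMem ?_ _)
          rintro ⟨x, hx, rfl⟩
          exact hyB (subset_toMeasurable _ _ (hB x (hAsub k hx).1))
    _ = N * volume B := by
        rw [lintegral_indicator_const (measurableSet_toMeasurable _ _), measure_toMeasurable]


lemma poly_sublevel (p : Polynomial ℝ) (c t : ℝ) (hc : 0 < c) (ht : 0 < t)
    (hlead : c ≤ |p.leadingCoeff|) :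
    volume {x : ℝ | |p.eval x| < c * t ^ p.natDegree} ≤ ENNReal.ofReal (2 * p.natDegree * t) := by
  let q := p.map (algebraMap ℝ ℂ)
  have hs : q.Splits := IsAlgClosed.splits q
  have hfac := hs.eq_prod_roots
  have hcard : q.roots.card = p.natDegree := by
    rw [← hs.natDegree_eq_card_roots, Polynomial.natDegree_map]
  have hsub : {x : ℝ | |p.eval x| < c * t ^ p.natDegree} ⊆
      ⋃ z ∈ q.roots.toFinset, Set.Ioo (z.re - t) (z.re + t) := by
    intro x hx
    by_contra hcon
    have hfar : ∀ z ∈ q.roots, t ≤ ‖(x : ℂ) - z‖ := by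
      intro z hz
      by_contra hlt
      push Not at hlt
      apply hcon
      simp only [Set.mem_iUnion]
      refine ⟨z, by simpa using hz, ?_⟩
      have h1 := (Complex.abs_re_le_norm ((x : ℂ) - z)).trans_lt hlt
      simp only [Complex.sub_re, Complex.ofReal_re] at h1
      rw [abs_lt] at h1
      constructor <;> linarith
    have heval : (‖q.eval (x : ℂ)‖ : ℝ) = |p.eval x| := by
      have : q.eval (x : ℂ) = ((p.eval x : ℝ) : ℂ) := by
        simp only [q]
        exact Polynomial.eval_map_algebraMap .. |>.trans (Polynomial.aeval_algebraMap_apply ℂ x p)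
      rw [this, Complex.norm_real, Real.norm_eq_abs]
    have hlc : ‖q.leadingCoeff‖ = |p.leadingCoeff| := by
      simp only [q]
      rw [Polynomial.leadingCoeff_map]
      simp
    have hprod : t ^ q.roots.card ≤ ((q.roots.map fun z => ‖(x : ℂ) - z‖).prod) := by
      have := Multiset.prod_map_le_prod_map₀ (s := q.roots) (fun _ => t) (fun z => ‖(x : ℂ) - z‖)
        (fun _ _ => ht.le) hfar
      simpa using this
    have hev : ‖q.eval (x:ℂ)‖ = ‖q.leadingCoeff‖ * (q.roots.map fun z => ‖(x : ℂ) - z‖).prod := by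
      conv_lhs => rw [hfac]
      rw [Polynomial.eval_mul, Polynomial.eval_C, Polynomial.eval_multiset_prod, norm_mul]
      congr 1
      have := (Multiset.prod_hom ((q.roots.map fun z => Polynomial.X - Polynomial.C z).map
        (Polynomial.eval (x : ℂ))) (normHom : ℂ →*₀ ℝ)).symm
      refine Eq.trans this ?_
      simp
    rw [heval, hlc] at hev
    have hx' : |p.eval x| < c * t ^ p.natDegree := hx
    rw [hev, ← hcard] at hx'
    have : c * t ^ q.roots.card ≤ |p.leadingCoeff| * (q.roots.map fun z => ‖(x : ℂ) - z‖).prod := by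
      gcongr
    linarith
  refine (measure_mono hsub).trans ((measure_biUnion_finset_le _ _).trans ?_)
  simp only [Real.volume_Ioo]
  have : ∀ z : ℂ, z.re + t - (z.re - t) = 2 * t := fun z => by ring
  simp only [this, Finset.sum_const, nsmul_eq_mul]
  rw [show 2 * (p.natDegree : ℝ) * t = p.natDegree * (2 * t) by ring,
    ENNReal.ofReal_mul (p := (p.natDegree : ℝ)) (by positivity), ENNReal.ofReal_natCast]
  gcongr
  rw [← hcard]
  exact Multiset.toFinset_card_le _

/-- Cube in `Fin n → ℝ`. -/
def cub (n : ℕ) (r : ℝ) : Set (Fin n → ℝ) := Set.pi Set.univ fun _ => Set.Ioo (-r) r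

lemma vol_cub (n : ℕ) (r : ℝ) (hr : 0 < r) : volume (cub n r) = ENNReal.ofReal ((2 * r) ^ n) := by
  rw [cub, Real.volume_pi_Ioo]
  simp only [Finset.prod_const, Finset.card_univ, Fintype.card_fin]
  rw [ENNReal.ofReal_pow (by positivity)]
  congr 2; ring

lemma meas_cub (n : ℕ) (r : ℝ) : MeasurableSet (cub n r) :=
  MeasurableSet.univ_pi fun _ => measurableSet_Ioo

lemma cons_mem_cub {n : ℕ} {r t : ℝ} {y : Fin n → ℝ} :
    (Fin.cons t y : Fin (n+1) → ℝ) ∈ cub (n+1) r ↔ t ∈ Set.Ioo (-r) r ∧ y ∈ cub n r := by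
  simp [cub, Set.mem_pi, Fin.forall_fin_succ]

/-- Lexicographically leading exponent. -/
def LexLead {n : ℕ} (Q : MvPolynomial (Fin n) ℝ) (α : Fin n →₀ ℕ) : Prop :=
  coeff α Q ≠ 0 ∧ ∀ β : Fin n →₀ ℕ, β ≠ α → coeff β Q ≠ 0 →
      ∃ j : Fin n, β j < α j ∧ ∀ k : Fin n, k < j → α k = β k

lemma lex_sublevel : ∀ {n : ℕ} (Q : MvPolynomial (Fin n) ℝ) (α : Fin n →₀ ℕ), LexLead Q α →
    ∃ C : ℝ, 0 < C ∧ ∀ r t : ℝ, 0 < r → 0 < t →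
      ENNReal.ofReal r * volume {x | x ∈ cub n r ∧ |eval x Q| < |coeff α Q| * t ^ (∑ i, α i)} ≤
        ENNReal.ofReal (C * t * r ^ n)
  | 0, Q, α, h => by
    refine ⟨1, one_pos, fun r t hr ht => ?_⟩
    have : {x | x ∈ cub 0 r ∧ |eval x Q| < |coeff α Q| * t ^ (∑ i, α i)} = ∅ := by
      ext x
      rw [MvPolynomial.eq_C_of_isEmpty Q]
      have h0 : 0 = α := Subsingleton.elim _ _
      simp [h0]
    rw [this]
    simp
  | n+1, Q, α, h => by
    obtain ⟨h1, h2⟩ := h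
    set q := finSuccEquiv ℝ n Q with hq
    have hdeg0 : q.coeff (α 0) ≠ 0 := by
      intro h0
      apply h1
      have := finSuccEquiv_coeff_coeff (R := ℝ) α.tail Q (α 0)
      rw [← hq, h0, Finsupp.cons_tail] at this
      simpa using this.symm
    have hnd : q.natDegree = α 0 := by
      apply le_antisymm _ (Polynomial.le_natDegree_of_ne_zero hdeg0)
      rw [Polynomial.natDegree_le_iff_coeff_eq_zero]
      intro N hN
      by_contra hne
      obtain ⟨m, hm⟩ := MvPolynomial.ne_zero_iff.1 hne
      rw [hq, finSuccEquiv_coeff_coeff] at hm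
      obtain ⟨j, hj1, hj2⟩ := h2 (m.cons N) (by rintro h; rw [← h] at hN; simp at hN) hm
      by_cases hj : j = 0
      · subst hj; simp at hj1; omega
      · have := hj2 0 (Fin.pos_iff_ne_zero.2 hj)
        simp at this; omega
    have hco : coeff α.tail (q.coeff (α 0)) = coeff α Q := by
      rw [hq, finSuccEquiv_coeff_coeff, Finsupp.cons_tail]
    have hL : LexLead (q.coeff (α 0)) α.tail := by
      refine ⟨by rw [hco]; exact h1, fun β hβ hβc => ?_⟩
      rw [hq, finSuccEquiv_coeff_coeff] at hβc
      obtain ⟨j, hj1, hj2⟩ := h2 (β.cons (α 0)) (by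
        intro h; apply hβ; rw [← h]; simp) hβc
      rcases Fin.eq_zero_or_eq_succ j with rfl | ⟨j, rfl⟩
      · simp at hj1
      · refine ⟨j, by simpa [Finsupp.tail_apply] using hj1, fun k hk => ?_⟩
        simpa [Finsupp.tail_apply] using hj2 k.succ (Fin.succ_lt_succ_iff.2 hk)
    obtain ⟨C, hC, ih⟩ := lex_sublevel _ _ hL
    rw [hco] at ih
    set c := |coeff α Q| with hc
    have hcpos : 0 < c := abs_pos.2 h1
    refine ⟨2 * C + 2 ^ n * (2 * (α 0 : ℝ)), by positivity, fun r t hr ht => ?_⟩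
    set S := {y | y ∈ cub n r ∧ |eval y (q.coeff (α 0))| < c * t ^ (∑ i, α.tail i)} with hS
    have hSm : MeasurableSet S := (meas_cub n r).inter
      (measurableSet_lt (measurable_abs.comp (meas_eval _)) measurable_const)
    have hTm : MeasurableSet {x | x ∈ cub (n+1) r ∧ |eval x Q| < c * t ^ (∑ i, α i)} :=
      (meas_cub (n+1) r).inter
      (measurableSet_lt (measurable_abs.comp (meas_eval _)) measurable_const)
    rw [vol_fin_succ _ hTm]
    have hpt : ∀ y : Fin n → ℝ, volume {s : ℝ | (Fin.cons s y : Fin (n+1) → ℝ) ∈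
        {x | x ∈ cub (n+1) r ∧ |eval x Q| < c * t ^ (∑ i, α i)}} ≤
        S.indicator (fun _ => ENNReal.ofReal (2 * r)) y +
        (cub n r).indicator (fun _ => ENNReal.ofReal (2 * (α 0 : ℝ) * t)) y := by
      intro y
      by_cases hy : y ∈ cub n r
      swap
      · have : {s : ℝ | (Fin.cons s y : Fin (n+1) → ℝ) ∈
          {x | x ∈ cub (n+1) r ∧ |eval x Q| < c * t ^ (∑ i, α i)}} = ∅ := by
          ext s
          simp [cons_mem_cub, hy]
        rw [this]; simp
      by_cases hyS : y ∈ S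
      · rw [Set.indicator_of_mem hyS]
        refine le_add_right ?_
        have : {s : ℝ | (Fin.cons s y : Fin (n+1) → ℝ) ∈
          {x | x ∈ cub (n+1) r ∧ |eval x Q| < c * t ^ (∑ i, α i)}} ⊆ Set.Ioo (-r) r := by
          intro s hs
          exact (cons_mem_cub.1 hs.1).1
        refine (measure_mono this).trans ?_
        rw [Real.volume_Ioo]
        apply le_of_eq; congr 1; ring
      · rw [Set.indicator_of_mem hy, Set.indicator_of_notMem hyS, zero_add]
        have hbig : c * t ^ (∑ i, α.tail i) ≤ |eval y (q.coeff (α 0))| := by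
          by_contra hlt
          exact hyS ⟨hy, not_le.1 hlt⟩
        have hcpos' : 0 < c * t ^ (∑ i, α.tail i) := by positivity
        have hne0 : eval y (q.coeff (α 0)) ≠ 0 := abs_pos.1 (hcpos'.trans_le hbig)
        have hnd' : (q.map (eval y)).natDegree = α 0 := by
          rw [← hnd]
          apply Polynomial.natDegree_map_of_leadingCoeff_ne_zero
          rwa [Polynomial.leadingCoeff, hnd]
        have hps := poly_sublevel (q.map (eval y)) _ t hcpos' ht (by
          rw [Polynomial.leadingCoeff, hnd', Polynomial.coeff_map]; exact hbig)
        rw [hnd'] at hps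
        refine le_trans (measure_mono ?_) hps
        intro s hs
        have hs2 := hs.2
        rw [MvPolynomial.eval_eq_eval_mv_eval', ← hq, Fin.sum_univ_succ, pow_add] at hs2
        simp only [Finsupp.tail_apply]
        show |Polynomial.eval s (q.map (eval y))| < _
        calc _ < _ := hs2
          _ = _ := by ring
    calc _ ≤ ENNReal.ofReal r * ∫⁻ y, (S.indicator (fun _ => ENNReal.ofReal (2 * r)) y +
        (cub n r).indicator (fun _ => ENNReal.ofReal (2 * (α 0 : ℝ) * t)) y) := by
          gcongr with y
          exact hpt y
      _ = ENNReal.ofReal (2 * r) * (ENNReal.ofReal r * volume S) + ENNReal.ofReal r * (ENNReal.ofReal (2 * (α 0 : ℝ) * t) *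
          ENNReal.ofReal ((2 * r) ^ n)) := by
          rw [lintegral_add_left (measurable_const.indicator hSm), lintegral_indicator_const hSm,
            lintegral_indicator_const (meas_cub n r), vol_cub n r hr]
          ring
      _ ≤ ENNReal.ofReal (2 * r) * ENNReal.ofReal (C * t * r ^ n) + ENNReal.ofReal r * (ENNReal.ofReal (2 * (α 0 : ℝ) * t) *
          ENNReal.ofReal ((2 * r) ^ n)) := by
          gcongr
          exact ih r t hr ht
      _ = _ := by
          rw [← ENNReal.ofReal_mul (by positivity), ← ENNReal.ofReal_mul (by positivity), ← ENNReal.ofReal_mul (by positivity),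
            ← ENNReal.ofReal_add (by positivity) (by positivity)]
          congr 1
          rw [mul_pow]; ring

lemma adm_sublevel {n : ℕ} (Q : MvPolynomial (Fin n) ℝ) (α : Fin n →₀ ℕ)
    (h : IsAdmissibleIndex Q α) :
    1 ≤ ∑ i, α i ∧ ∃ C : ℝ, 0 < C ∧ ∀ r t : ℝ, 0 < r → 0 < t →
      ENNReal.ofReal r * volume {x | x ∈ cub n r ∧ |eval x Q| < t ^ (∑ i, α i)} ≤
        ENNReal.ofReal (C * t * r ^ n) := by
  obtain ⟨h1, σ, ⟨h0, hσ⟩, h2⟩ := h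
  have hk : 1 ≤ ∑ i, α i := hσ.trans (Finset.single_le_sum (f := fun i => α i) (fun _ _ => Nat.zero_le _) (Finset.mem_univ _))
  refine ⟨hk, ?_⟩
  have hcoef : ∀ β : Fin n →₀ ℕ, coeff (β.mapDomain σ.symm) (rename σ.symm Q) = coeff β Q :=
    fun β => coeff_rename_mapDomain _ σ.symm.injective _ _
  have hap : ∀ (β : Fin n →₀ ℕ) j, β.mapDomain σ.symm j = β (σ j) := by
    intro β j
    rw [Finsupp.mapDomain_equiv_apply]; simp
  have hL : LexLead (rename σ.symm Q) (α.mapDomain σ.symm) := by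
    refine ⟨by rwa [hcoef], fun β hβ hc => ?_⟩
    obtain ⟨γ, rfl⟩ : ∃ γ : Fin n →₀ ℕ, γ.mapDomain σ.symm = β :=
      ⟨β.mapDomain σ, by rw [← Finsupp.mapDomain_comp]; simp⟩
    rw [hcoef] at hc
    obtain ⟨j, hj, hj2⟩ := h2 γ (by rintro rfl; exact hβ rfl) hc
    exact ⟨j, by simpa only [hap] using hj, by simpa only [hap] using hj2⟩
  obtain ⟨C, hC, H⟩ := lex_sublevel _ _ hL
  rw [hcoef] at H
  have hsum : ∑ i, (α.mapDomain σ.symm) i = ∑ i, α i := by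
    simp only [hap]
    exact Equiv.sum_comp σ α
  rw [hsum] at H
  set k := ∑ i, α i with hkdef
  set c := |coeff α Q| with hc
  have hcpos : 0 < c := abs_pos.2 h1
  set d : ℝ := c ^ (-(1 / (k:ℝ))) with hd
  have hdpos : 0 < d := Real.rpow_pos_of_pos hcpos _
  have hdk : c * d ^ k = 1 := by
    rw [hd, ← Real.rpow_natCast, ← Real.rpow_mul hcpos.le]
    have : (k : ℝ) ≠ 0 := by positivity
    rw [show -(1 / (k:ℝ)) * k = -1 by field_simp, Real.rpow_neg_one]
    field_simp
  refine ⟨C * d, by positivity, fun r t hr ht => ?_⟩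
  have hH := H r (d * t) hr (by positivity)
  have e1 : c * (d * t) ^ k = t ^ k := by
    rw [mul_pow, ← mul_assoc, hdk, one_mul]
  rw [e1, ← mul_assoc] at hH
  refine le_trans (le_of_eq ?_) hH
  congr 1
  have hmp := volume_measurePreserving_piCongrLeft (fun _ : Fin n => ℝ) σ.symm
  have hTm : MeasurableSet {x | x ∈ cub n r ∧ |eval x (rename σ.symm Q)| < t ^ k} :=
      (meas_cub n r).inter
      (measurableSet_lt (measurable_abs.comp (meas_eval _)) measurable_const)
  rw [← hmp.measure_preimage hTm.nullMeasurableSet]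
  congr 1
  ext x
  have hx : (MeasurableEquiv.piCongrLeft (fun _ : Fin n => ℝ) σ.symm) x = fun j => x (σ j) := by
    ext j
    have := Equiv.piCongrLeft_apply_apply (fun _ : Fin n => ℝ) σ.symm x (σ j)
    rw [Equiv.symm_apply_apply] at this
    exact this
  show _ ↔ _ ∧ _
  rw [hx, eval_rename]
  have e2 : ((fun j => x (σ j)) ∘ σ.symm) = x := by ext j; simp
  rw [e2]
  have e3 : (fun j => x (σ j)) ∈ cub n r ↔ x ∈ cub n r := by
    simp only [cub, Set.mem_pi, Set.mem_univ, true_imp_iff]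
    exact σ.forall_congr_left (p := fun j => x (σ j) ∈ Set.Ioo (-r) r) |>.trans (by simp)
  rw [e3]
  rfl

/-- The map `(P_1, …, P_m, x_{m+1}, …, x_n)`. -/
noncomputable def pmap {n : ℕ} (P : MvPolynomial (Fin n) ℝ) (m : ℕ) (i : Fin n) : MvPolynomial (Fin n) ℝ :=
  if (i : ℕ) < m then Pseq P (i + 1) else X i

lemma pmap_det {n : ℕ} (P : MvPolynomial (Fin n) ℝ) (m : ℕ) (hm1 : 1 ≤ m) (hmn : m ≤ n) :
    (jac (pmap P m)).det = Pseq P (m + 1) := by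
  obtain ⟨m, rfl⟩ : ∃ m', m = m' + 1 := ⟨m - 1, by omega⟩
  rw [Pseq, dif_pos hmn]
  rw [Matrix.twoBlockTriangular_det _ (fun i : Fin n => (i : ℕ) < m + 1)]
  · have h2 : (Matrix.toSquareBlockProp (jac (pmap P (m+1))) fun i : Fin n => ¬ (i : ℕ) < m + 1) = 1 := by
      ext1 i j
      simp only [Matrix.toSquareBlockProp_def, jac, pmap, Matrix.of_apply, if_neg i.2, pderiv_X, Matrix.one_apply]
      simp only [Pi.single_apply, Subtype.ext_iff]
    rw [h2, Matrix.det_one, mul_one]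
    let e : Fin (m+1) ≃ {i : Fin n // (i : ℕ) < m + 1} :=
      { toFun := fun i => ⟨Fin.castLE hmn i, i.2⟩
        invFun := fun i => ⟨i.1, i.2⟩
        left_inv := fun i => rfl
        right_inv := fun i => rfl }
    rw [← Matrix.det_submatrix_equiv_self e]
    congr 1
    ext1 i j
    simp [Matrix.toSquareBlockProp_def, jac, pmap, e, Nat.lt_succ_iff.1 i.2]
  · intro i hi j hj
    simp only [jac, pmap, Matrix.of_apply, if_neg hi, pderiv_X]
    rw [Pi.single_apply, if_neg]
    rintro rfl
    exact hi hj

lemma level_bound {n : ℕ} (P : MvPolynomial (Fin n) ℝ) (m : ℕ) (hm1 : 1 ≤ m) (hmn : m ≤ n) :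
    ∃ N : ℕ, ∀ (r : ℝ) (η : ℕ → ℝ), 0 < r → (∀ i, 0 < η i) →
      ENNReal.ofReal (η m) * volume {x | x ∈ cub n r ∧ (∀ i < m, |eval x (Pseq P (i+1))| < η i) ∧
        η m ≤ |eval x (Pseq P (m+1))|} ≤
      ENNReal.ofReal (N * (2 ^ n * ((∏ i ∈ Finset.range m, η i) * r ^ (n - m)))) := by
  obtain ⟨N, hN⟩ := area_bound (pmap P m)
  rw [pmap_det P m hm1 hmn] at hN
  refine ⟨N, fun r η hr hη => ?_⟩
  set E := {x | x ∈ cub n r ∧ (∀ i < m, |eval x (Pseq P (i+1))| < η i) ∧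
        η m ≤ |eval x (Pseq P (m+1))|} with hE
  have hEm : MeasurableSet E := by
    refine (meas_cub n r).inter (MeasurableSet.inter ?_ ?_)
    · have : {x : Fin n → ℝ | ∀ i < m, |eval x (Pseq P (i+1))| < η i} =
        ⋂ i, ⋂ (_ : i < m), {x | |eval x (Pseq P (i+1))| < η i} := by ext x; simp
      refine (congrArg MeasurableSet this).mpr ?_
      exact MeasurableSet.iInter fun i => MeasurableSet.iInter fun _ =>
        measurableSet_lt (measurable_abs.comp (meas_eval _)) measurable_const
    · exact measurableSet_le measurable_const (measurable_abs.comp (meas_eval _))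
  let b : ℕ → ℝ := fun i => if i < m then η i else r
  have hb : ∀ i, 0 < b i := by intro i; simp only [b]; split_ifs; exacts [hη i, hr]
  have hB := hN E hEm (fun x hx => by
    have := (hη m).trans_le hx.2.2
    exact abs_pos.1 this) (Set.pi Set.univ fun i : Fin n => Set.Ioo (-(b i)) (b i)) (by
    intro x hx i _
    simp only [pmap, b]
    split_ifs with hi
    · exact abs_lt.1 (hx.2.1 i hi)
    · rw [eval_X]; exact hx.1 i trivial)
  have hvol : volume (Set.pi Set.univ fun i : Fin n => Set.Ioo (-(b i)) (b i)) =
      ENNReal.ofReal (2 ^ n * ((∏ i ∈ Finset.range m, η i) * r ^ (n - m))) := by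
    rw [Real.volume_pi_Ioo, ← ENNReal.ofReal_prod_of_nonneg (fun i _ => by have := hb i; linarith)]
    congr 1
    have e1 : ∀ i : Fin n, b i - -(b i) = 2 * b i := fun i => by ring
    simp only [e1]
    rw [Finset.prod_mul_distrib]
    congr 1
    · simp
    · rw [Fin.prod_univ_eq_prod_range b n]
      obtain ⟨q, rfl⟩ := Nat.exists_eq_add_of_le hmn
      rw [Finset.prod_range_add]
      congr 1
      · exact Finset.prod_congr rfl fun i hi => by simp [b, Finset.mem_range.1 hi]
      · simp [b]
  rw [hvol, ← ENNReal.ofReal_natCast, ← ENNReal.ofReal_mul (by positivity)] at hB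
  refine le_trans ?_ hB
  rw [← setLIntegral_const]
  exact setLIntegral_mono' hEm fun x hx => ENNReal.ofReal_le_ofReal hx.2.2

lemma main_sublevel {n : ℕ} (P : MvPolynomial (Fin n) ℝ) (l : ℕ) (hl1 : 1 ≤ l) (hln : l ≤ n)
    (α : Fin n →₀ ℕ) (hα : IsAdmissibleIndex (Pseq P (l + 1)) α) :
    ∃ C : ℝ, 0 < C ∧ ∀ r ε v : ℝ, 0 < r → 0 < ε → 0 < v →
      v ^ ((∑ i, α i) + 2 ^ (l - 1)) * r ^ (2 ^ (l-1)) = ε ^ (2 ^ (l-1)) * r →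
      ENNReal.ofReal r * volume {x | x ∈ cub n r ∧ |eval x P| < ε} ≤ ENNReal.ofReal (C * v * r ^ n) := by
  obtain ⟨hk, C0, hC0, h0⟩ := adm_sublevel _ _ hα
  have := fun m : ℕ => fun h : 1 ≤ m ∧ m ≤ n => level_bound P m h.1 h.2
  choose! N hN using this
  set k := ∑ i, α i with hkdef
  refine ⟨(∑ m ∈ Finset.Icc 1 l, (N m : ℝ) * 2 ^ n) + C0, by positivity, fun r ε v hr hε hv hvv => ?_⟩
  set u : ℝ := ε / (r * v) with hu
  have hupos : 0 < u := by positivity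
  let η : ℕ → ℝ := fun i => if i = 0 then ε else r * u ^ (2 ^ (i - 1))
  have hη : ∀ i, 0 < η i := by intro i; simp only [η]; split_ifs <;> positivity
  have hηl : η l = v ^ k := by
    simp only [η, if_neg (by omega : l ≠ 0), hu]
    rw [div_pow, mul_pow]
    rw [pow_add] at hvv
    field_simp
    linarith
  have hprod : ∀ m, 1 ≤ m → (∏ i ∈ Finset.range m, η i) * u = ε * r ^ (m - 1) * u ^ (2 ^ (m-1)) := by
    intro m hm
    induction m, hm using Nat.le_induction with
    | base => simp [η]
    | succ m hm ih =>
      rw [Finset.prod_range_succ, mul_right_comm, ih]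
      simp only [η, if_neg (by omega : m ≠ 0)]
      obtain ⟨m, rfl⟩ : ∃ m', m = m' + 1 := ⟨m - 1, by omega⟩
      simp only [Nat.add_sub_cancel]
      rw [pow_succ 2 m, pow_mul, pow_succ r m]
      ring
  let S : ℕ → Set (Fin n → ℝ) := fun m => {x | x ∈ cub n r ∧ (∀ i < m, |eval x (Pseq P (i+1))| < η i) ∧
        η m ≤ |eval x (Pseq P (m+1))|}
  have hS : ∀ m ∈ Finset.Icc 1 l, ENNReal.ofReal r * volume (S m) ≤ ENNReal.ofReal ((N m * 2 ^ n) * v * r ^ n) := by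
    intro m hm
    rw [Finset.mem_Icc] at hm
    have hmn : m ≤ n := hm.2.trans hln
    have h1 := hN m ⟨hm.1, hmn⟩ r η hr hη
    have hηm : η m = r * u ^ (2 ^ (m-1)) := by simp only [η, if_neg (by omega : m ≠ 0)]
    have hid : (∏ i ∈ Finset.range m, η i) * r ^ (n - m) = (v * r ^ n) * (η m / r) := by
      have h2 := hprod m hm.1
      have h3 : r ^ n = r ^ (m - 1) * r ^ (n - m) * r := by
        rw [← pow_add, ← pow_succ]; congr 1; omega
      rw [hηm, h3]
      have h4 : u * (r * v) = ε := by rw [hu]; field_simp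
      apply mul_right_cancel₀ hupos.ne'
      rw [mul_right_comm, h2, ← h4]
      field_simp
    rw [hid] at h1
    have h5 : ENNReal.ofReal r * volume (S m) = ENNReal.ofReal (r / η m) * (ENNReal.ofReal (η m) * volume (S m)) := by
      rw [← mul_assoc, ← ENNReal.ofReal_mul (by have := hη m; positivity), div_mul_cancel₀ _ (hη m).ne']
    rw [h5]
    calc _ ≤ ENNReal.ofReal (r / η m) * ENNReal.ofReal (N m * (2 ^ n * ((v * r ^ n) * (η m / r)))) := by
          gcongr
      _ = _ := by
          have := hη m
          rw [← ENNReal.ofReal_mul (by positivity)]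
          congr 1
          field_simp
  have hsub : {x | x ∈ cub n r ∧ |eval x P| < ε} ⊆ (⋃ m ∈ Finset.Icc 1 l, S m) ∪
      {x | x ∈ cub n r ∧ |eval x (Pseq P (l+1))| < v ^ k} := by
    rintro x ⟨hx, hxP⟩
    by_cases hex : ∃ m, m ≤ l ∧ η m ≤ |eval x (Pseq P (m+1))|
    · left
      classical
      have hs := Nat.find_spec hex
      have hmin := fun i => Nat.find_min hex (m := i)
      set m := Nat.find hex
      have hm0 : m ≠ 0 := by
        intro h
        have h1 := hs.2
        rw [h] at h1
        simp only [η, if_true, Pseq, zero_add] at h1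
        linarith
      simp only [Set.mem_iUnion]
      refine ⟨m, by rw [Finset.mem_Icc]; omega, hx, fun i hi => ?_, hs.2⟩
      by_contra hcon
      exact hmin i hi ⟨by omega, not_lt.1 hcon⟩
    · right
      push Not at hex
      exact ⟨hx, hηl ▸ hex l le_rfl⟩
  calc _ ≤ ENNReal.ofReal r * ((∑ m ∈ Finset.Icc 1 l, volume (S m)) +
          volume {x | x ∈ cub n r ∧ |eval x (Pseq P (l+1))| < v ^ k}) := by
        gcongr
        refine (measure_mono hsub).trans ((measure_union_le _ _).trans ?_)
        gcongr
        exact measure_biUnion_finset_le _ _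
    _ ≤ (∑ m ∈ Finset.Icc 1 l, ENNReal.ofReal ((N m * 2 ^ n) * v * r ^ n)) + ENNReal.ofReal (C0 * v * r ^ n) := by
        rw [mul_add, Finset.mul_sum]
        gcongr with m hm
        · exact hS m hm
        · exact h0 r v hr hv
    _ = _ := by
        rw [← ENNReal.ofReal_sum_of_nonneg (fun m _ => by positivity), ← ENNReal.ofReal_add (by positivity) (by positivity)]
        congr 1
        rw [add_mul, add_mul, Finset.sum_mul, Finset.sum_mul]

lemma int_bound {X : Type*} [MeasurableSpace X] (ν : Measure X) (g : X → ℝ) (hg : Measurable g)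
    (T K0 K τ μ : ℝ) (hT : 0 < T) (hK0 : 0 ≤ K0) (hK : 0 ≤ K) (hμ : 0 < μ) (hμτ : μ < τ)
    (h0 : ν Set.univ ≤ ENNReal.ofReal K0)
    (h : ∀ j : ℕ, ν {x | |g x| < T * (1/2) ^ j} ≤ ENNReal.ofReal (K * ((1/2 : ℝ) ^ τ) ^ j)) :
    ∫⁻ x, (ENNReal.ofReal |g x|) ^ (-μ) ∂ν ≤
      ENNReal.ofReal (T ^ (-μ) * (K0 + K * 2 ^ μ * (1 - (1/2 : ℝ) ^ (τ - μ))⁻¹)) := by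
  have hTμ : 0 < T ^ (-μ) := Real.rpow_pos_of_pos hT _
  set A : ℕ → Set X := fun j => {x | |g x| < T * (1/2) ^ j} with hA
  have hAm : ∀ j, MeasurableSet (A j) := fun j =>
    measurableSet_lt (measurable_abs.comp hg) measurable_const
  let w : ℕ → ℝ := fun j => T ^ (-μ) * 2 ^ μ * ((2 : ℝ) ^ μ) ^ j
  have hw : ∀ j, 0 < w j := fun j => by positivity
  have h2μ : (1 : ℝ) ≤ 2 ^ μ := Real.one_le_rpow (by norm_num) hμ.le
  have hpow : ∀ y : ℝ, 0 < y → (ENNReal.ofReal y) ^ (-μ) = ENNReal.ofReal (y ^ (-μ)) := fun y hy =>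
    ENNReal.ofReal_rpow_of_pos hy
  have hpt : ∀ x, (ENNReal.ofReal |g x|) ^ (-μ) ≤ ENNReal.ofReal (T ^ (-μ)) +
      ∑' j, (A j).indicator (fun _ => ENNReal.ofReal (w j)) x := by
    intro x
    by_cases hz : g x = 0
    · have htop : ∑' j, (A j).indicator (fun _ => ENNReal.ofReal (w j)) x = ⊤ := by
        rw [eq_top_iff]
        have hc : ∑' _ : ℕ, ENNReal.ofReal (T ^ (-μ)) = ⊤ :=
          ENNReal.tsum_const_eq_top_of_ne_zero (by simpa using hTμ)
        rw [← hc]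
        refine ENNReal.tsum_le_tsum fun j => ?_
        have hx : x ∈ A j := by
          show |g x| < _
          rw [hz, abs_zero]; positivity
        rw [Set.indicator_of_mem hx]
        apply ENNReal.ofReal_le_ofReal
        have : (1:ℝ) ≤ (2 ^ μ) ^ j := one_le_pow₀ h2μ
        calc T ^ (-μ) = T ^ (-μ) * 1 * 1 := by ring
          _ ≤ w j := by simp only [w]; gcongr
      rw [htop]; simp
    have hgp : 0 < |g x| := abs_pos.2 hz
    rw [hpow _ hgp]
    by_cases hTg : T ≤ |g x|
    · refine le_add_right (ENNReal.ofReal_le_ofReal ?_)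
      exact Real.rpow_le_rpow_of_nonpos hT hTg (by linarith)
    · push Not at hTg
      obtain ⟨j, hj1, hj2⟩ := exists_nat_pow_near_of_lt_one (x := |g x| / T) (y := (1/2 : ℝ)) (by positivity)
        (by rw [div_le_one hT]; exact hTg.le) (by norm_num) (by norm_num)
      refine le_add_left ?_
      rcases hj2.lt_or_eq with hlt | heq
      · have hx : x ∈ A j := by
          show |g x| < _
          rw [div_lt_iff₀ hT] at hlt; linarith
        refine le_trans ?_ (ENNReal.le_tsum j)
        rw [Set.indicator_of_mem hx]
        apply ENNReal.ofReal_le_ofReal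
        rw [lt_div_iff₀ hT] at hj1
        calc |g x| ^ (-μ) ≤ ((1/2) ^ (j+1) * T) ^ (-μ) :=
              Real.rpow_le_rpow_of_nonpos (by positivity) hj1.le (by linarith)
          _ = w j := by
              simp only [w]
              rw [Real.mul_rpow (by positivity) hT.le, ← Real.rpow_natCast, ← Real.rpow_mul (by norm_num),
                ← Real.rpow_natCast, ← Real.rpow_mul (by norm_num), one_div, Real.inv_rpow (by norm_num),
                ← Real.rpow_neg (by norm_num), mul_assoc (T ^ (-μ)), ← Real.rpow_add (by norm_num), mul_comm]
              congr 2
              push_cast; ring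
      · have hj0 : j ≠ 0 := by
          rintro rfl
          rw [pow_zero, div_eq_one_iff_eq hT.ne'] at heq
          linarith
        obtain ⟨i, rfl⟩ := Nat.exists_eq_succ_of_ne_zero hj0
        have hge : |g x| = (1/2) ^ (i+1) * T := by
          rw [div_eq_iff hT.ne'] at heq; exact heq
        have hx : x ∈ A i := by
          show |g x| < _
          rw [hge, pow_succ]
          have : 0 < T * (1/2 : ℝ) ^ i := by positivity
          linarith
        refine le_trans ?_ (ENNReal.le_tsum i)
        rw [Set.indicator_of_mem hx]
        apply ENNReal.ofReal_le_ofReal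
        calc |g x| ^ (-μ) = ((1/2) ^ (i+1) * T) ^ (-μ) := by rw [hge]
          _ = w i := by
              simp only [w]
              rw [Real.mul_rpow (by positivity) hT.le, ← Real.rpow_natCast, ← Real.rpow_mul (by norm_num),
                ← Real.rpow_natCast, ← Real.rpow_mul (by norm_num), one_div, Real.inv_rpow (by norm_num),
                ← Real.rpow_neg (by norm_num), mul_assoc (T ^ (-μ)), ← Real.rpow_add (by norm_num), mul_comm]
              congr 2
              push_cast; ring
          _ ≤ _ := le_rfl
  set q : ℝ := (1/2 : ℝ) ^ (τ - μ) with hq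
  have hq0 : 0 < q := by positivity
  have hq1 : q < 1 := Real.rpow_lt_one (by norm_num) (by norm_num) (by linarith)
  have hqe : (2 : ℝ) ^ μ * (1/2 : ℝ) ^ τ = q := by
    rw [hq, Real.rpow_sub (by norm_num), one_div, Real.inv_rpow (by norm_num) μ]
    field_simp
  have hsum := hasSum_geometric_of_lt_one hq0.le hq1
  calc _ ≤ ∫⁻ x, (ENNReal.ofReal (T ^ (-μ)) +
      ∑' j, (A j).indicator (fun _ => ENNReal.ofReal (w j)) x) ∂ν := lintegral_mono hpt
    _ = ENNReal.ofReal (T ^ (-μ)) * ν Set.univ + ∑' j, ENNReal.ofReal (w j) * ν (A j) := by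
        rw [lintegral_add_left measurable_const, lintegral_const,
          lintegral_tsum fun j => (measurable_const.indicator (hAm j)).aemeasurable]
        congr 2
        ext j
        rw [lintegral_indicator_const (hAm j)]
    _ ≤ ENNReal.ofReal (T ^ (-μ)) * ENNReal.ofReal K0 + ∑' j, ENNReal.ofReal ((T ^ (-μ) * (K * 2 ^ μ)) * q ^ j) := by
        gcongr with j
        calc _ ≤ ENNReal.ofReal (w j) * ENNReal.ofReal (K * ((1/2 : ℝ) ^ τ) ^ j) := by
              gcongr; exact h j
          _ = _ := by
              rw [← ENNReal.ofReal_mul (hw j).le]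
              congr 1
              rw [← hqe, mul_pow]; simp only [w]; ring
    _ = _ := by
        rw [← ENNReal.ofReal_tsum_of_nonneg (fun j => by positivity) (hsum.summable.mul_left _), tsum_mul_left,
          hsum.tsum_eq, ← ENNReal.ofReal_mul hTμ.le]
        have : 0 < (1 - q)⁻¹ := inv_pos.2 (by linarith)
        rw [← ENNReal.ofReal_add (by positivity) (by positivity)]
        congr 1; ring

lemma v_rel (ε r : ℝ) (hε : 0 < ε) (hr : 0 < r) (k M : ℕ) (hM : 1 ≤ M) :
    (ε ^ ((M:ℝ) / (M + k)) * r ^ ((1 - (M:ℝ)) / (M + k))) ^ (k + M) * r ^ M = ε ^ M * r := by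
  have hpos : (0 : ℝ) < M + k := by positivity
  rw [mul_pow, ← Real.rpow_natCast, ← Real.rpow_natCast, ← Real.rpow_natCast r M, ← Real.rpow_natCast ε M,
    ← Real.rpow_mul hε.le, ← Real.rpow_mul hr.le, mul_assoc, ← Real.rpow_add hr]
  push_cast
  rw [show (M:ℝ) / (M + k) * (k + M) = M by field_simp; ring,
    show (1 - (M:ℝ)) / (M + k) * (k + M) + M = 1 by field_simp; ring, Real.rpow_one]

lemma cube_bound {n : ℕ} (P : MvPolynomial (Fin n) ℝ) (l : ℕ) (hl1 : 1 ≤ l) (hln : l ≤ n)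
    (α : Fin n →₀ ℕ) (hα : IsAdmissibleIndex (Pseq P (l + 1)) α)
    (τ θ μ : ℝ) (hτ : τ = (2 : ℝ) ^ (l - 1) / ((2 : ℝ) ^ (l - 1) + (∑ i, α i : ℝ)))
    (hθ : θ = (1 - (2 : ℝ) ^ (l - 1)) / ((2 : ℝ) ^ (l - 1) + (∑ i, α i : ℝ)))
    (hμ : 0 < μ) (hμτ : μ < τ) :
    ∃ C : ℝ, 0 < C ∧ ∀ r : ℝ, 0 < r →
      ∫⁻ x in cub n r, (ENNReal.ofReal |eval x P|) ^ (-μ) ≤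
        ENNReal.ofReal (C * r ^ ((n : ℝ) - μ * ((1 - θ) / τ))) := by
  obtain ⟨C, hC, H⟩ := main_sublevel P l hl1 hln α hα
  have hτ0 : 0 < τ := hμ.trans hμτ
  set k := ∑ i, α i with hk
  have hkc : (∑ i, α i : ℝ) = (k : ℝ) := by rw [hk]; push_cast; rfl
  rw [hkc] at hτ hθ
  have hM : ((2 : ℝ) ^ (l-1)) = ((2 ^ (l-1) : ℕ) : ℝ) := by push_cast; rfl
  rw [hM] at hτ hθ
  have hM1 : 1 ≤ 2 ^ (l-1) := Nat.one_le_two_pow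
  have hq1 : (1/2 : ℝ) ^ (τ - μ) < 1 := Real.rpow_lt_one (by norm_num) (by norm_num) (by linarith)
  have hq2 : 0 < (1 - (1/2 : ℝ) ^ (τ - μ))⁻¹ := inv_pos.2 (by linarith)
  refine ⟨2 ^ n + C * 2 ^ μ * (1 - (1/2 : ℝ) ^ (τ - μ))⁻¹, by positivity, fun r hr => ?_⟩
  set T := r ^ ((1 - θ) / τ) with hT
  have hTp : 0 < T := by positivity
  have hTτ : T ^ τ * r ^ θ = r := by
    rw [hT, ← Real.rpow_mul hr.le, ← Real.rpow_add hr, div_mul_cancel₀ _ hτ0.ne']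
    simp
  have := int_bound (volume.restrict (cub n r)) (fun x => eval x P) (meas_eval P) T ((2 * r) ^ n) (C * r ^ n) τ μ
    hTp (by positivity) (by positivity) hμ hμτ (by rw [Measure.restrict_apply_univ, vol_cub n r hr]) (by
      intro j
      have hε : 0 < T * (1/2 : ℝ) ^ j := by positivity
      have h1 := H r (T * (1/2) ^ j) ((T * (1/2) ^ j) ^ τ * r ^ θ) hr hε (by positivity) (by
        rw [hτ, hθ]; exact v_rel _ r hε hr k _ hM1)
      have h2 : (T * (1/2) ^ j) ^ τ * r ^ θ = r * ((1/2 : ℝ) ^ τ) ^ j := by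
        rw [Real.mul_rpow hTp.le (by positivity), mul_right_comm, hTτ]
        congr 1
        rw [← Real.rpow_natCast, ← Real.rpow_mul (by norm_num), ← Real.rpow_natCast, ← Real.rpow_mul (by norm_num), mul_comm]
      rw [h2, show C * (r * ((1/2 : ℝ) ^ τ) ^ j) * r ^ n = r * (C * r ^ n * ((1/2 : ℝ) ^ τ) ^ j) by ring,
        ENNReal.ofReal_mul hr.le] at h1
      rw [ENNReal.mul_le_mul_iff_right (by simpa using hr) ENNReal.ofReal_ne_top] at h1
      refine le_trans (le_of_eq ?_) h1
      have hms : MeasurableSet {x : Fin n → ℝ | |eval x P| < T * (1/2) ^ j} :=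
        measurableSet_lt (measurable_abs.comp (meas_eval _)) measurable_const
      rw [Measure.restrict_apply hms]
      congr 1
      ext x
      exact and_comm)
  refine this.trans (le_of_eq ?_)
  congr 1
  rw [hT, ← Real.rpow_mul hr.le, show (n:ℝ) - μ * ((1 - θ) / τ) = (1 - θ) / τ * -μ + n by ring,
    Real.rpow_add hr, Real.rpow_natCast, mul_pow]
  ring

lemma rpow_between (r a b e : ℝ) (hr : 0 < r) (h1 : b ≤ e) (h2 : e ≤ a) : r ^ e ≤ r ^ a + r ^ b := by
  have ha : 0 < r ^ a := by positivity
  have hb : 0 < r ^ b := by positivity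
  rcases le_total 1 r with h | h
  · have := Real.rpow_le_rpow_of_exponent_le h h2
    linarith
  · have := Real.rpow_le_rpow_of_exponent_ge hr h h1
    linarith

lemma expo_ineq (M k τ θ μ : ℝ) (hM : 1 ≤ M) (hk : 1 ≤ k) (hτ : τ = M / (M + k)) (hθ : θ = (1 - M) / (M + k))
    (hμ : 0 < μ) (hμτ : μ < τ) :
    θ - τ / μ ≤ - (μ * ((1 - θ) / τ)) ∧ - (μ * ((1 - θ) / τ)) ≤ - (μ * (k + 1) / k) := by
  have hpos : 0 < M + k := by linarith
  have hτ0 : 0 < τ := hμ.trans hμτ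
  have hθ0 : θ ≤ 0 := by rw [hθ]; exact div_nonpos_of_nonpos_of_nonneg (by linarith) hpos.le
  constructor
  · have h1 : μ * ((1 - θ) / τ) ≤ 1 - θ := by
      rw [← mul_div_assoc, div_le_iff₀ hτ0]
      nlinarith
    have h2 : 1 ≤ τ / μ := by rw [le_div_iff₀ hμ]; linarith
    linarith
  · have h3 : (k + 1) / k ≤ (1 - θ) / τ := by
      have : (1 - θ) / τ = (2 * M + k - 1) / M := by
        rw [hτ, hθ]; field_simp; ring
      rw [this, div_le_div_iff₀ (by linarith) (by linarith)]
      nlinarith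
    have := mul_le_mul_of_nonneg_left h3 hμ.le
    rw [mul_div_assoc]
    linarith

lemma cube_lintegral {n : ℕ} (P : MvPolynomial (Fin n) ℝ) (r μ : ℝ) :
    ∫⁻ x in cube n r, (ENNReal.ofReal |eval (fun i => x i) P|) ^ (-μ) =
      ∫⁻ x in cub n r, (ENNReal.ofReal |eval x P|) ^ (-μ) := by
  have hm : Measurable fun x : Fin n → ℝ => (ENNReal.ofReal |eval x P|) ^ (-μ) :=
    (ENNReal.measurable_ofReal.comp (measurable_abs.comp (meas_eval P))).pow_const _
  rw [← (PiLp.volume_preserving_ofLp (Fin n)).setLIntegral_comp_preimage (meas_cub n r) hm]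
  congr 2
  ext x
  simp [cube, cub, Set.mem_pi]

/-- **Proposition 4.2.** Let `n ≥ 2` and `P` a polynomial on `ℝ^n` with `P(0) = 0`,
`deg P_{l+1} ≥ 1` for some `1 ≤ l ≤ n`, and `α` an admissible index for `P_{l+1}`. With
`θ = (1-2^{l-1})/(2^{l-1}+|α|)` and `τ = 2^{l-1}/(2^{l-1}+|α|)`, for every `μ ∈ (0, τ)`
there is `C > 0` (depending only on the coefficients of `P_1, …, P_{l+1}` and on `α`)
with `∫_{Δ_r^n} |P|^{-μ} ≤ C [r^{n - μ(|α|+1)/|α|} + r^{n+θ-τ/μ}]` for all `r > 0`. In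
particular the integration index satisfies `i(P) ≥ τ`. -/
theorem statement12 (n : ℕ) (hn : 2 ≤ n) (P : MvPolynomial (Fin n) ℝ)
    (hP0 : eval (fun _ => (0 : ℝ)) P = 0)
    (l : ℕ) (hl1 : 1 ≤ l) (hln : l ≤ n)
    (hdeg : 1 ≤ (Pseq P (l + 1)).totalDegree)
    (α : Fin n →₀ ℕ) (hα : IsAdmissibleIndex (Pseq P (l + 1)) α) :
    (∀ μ : ℝ, 0 < μ →
        μ < ((2 : ℝ) ^ (l - 1)) / ((2 : ℝ) ^ (l - 1) + (∑ i, α i : ℝ)) →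
        ∃ C : ℝ, 0 < C ∧ ∀ r : ℝ, 0 < r →
          ∫⁻ x in cube n r, (ENNReal.ofReal |eval (fun i => x i) P|) ^ (-μ) ≤
            ENNReal.ofReal (C *
              (r ^ ((n : ℝ) - μ * ((∑ i, α i : ℝ) + 1) / (∑ i, α i : ℝ)) +
                r ^ ((n : ℝ) +
                  (1 - (2 : ℝ) ^ (l - 1)) / ((2 : ℝ) ^ (l - 1) + (∑ i, α i : ℝ)) -
                  (((2 : ℝ) ^ (l - 1)) / ((2 : ℝ) ^ (l - 1) + (∑ i, α i : ℝ))) / μ)))) ∧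
    (∀ t : ℝ, 0 < t →
        t < ((2 : ℝ) ^ (l - 1)) / ((2 : ℝ) ^ (l - 1) + (∑ i, α i : ℝ)) →
        ∃ U ∈ nhds (0 : EuclideanSpace ℝ (Fin n)),
          ∫⁻ x in U, (ENNReal.ofReal |eval (fun i => x i) P|) ^ (-t) < ⊤) := by
  have hk1 := (adm_sublevel _ _ hα).1
  have hk1' : (1 : ℝ) ≤ (∑ i, α i : ℝ) := by exact_mod_cast hk1
  have hM1 : (1 : ℝ) ≤ (2 : ℝ) ^ (l - 1) := one_le_pow₀ (by norm_num)
  have main : ∀ μ : ℝ, 0 < μ →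
        μ < ((2 : ℝ) ^ (l - 1)) / ((2 : ℝ) ^ (l - 1) + (∑ i, α i : ℝ)) →
        ∃ C : ℝ, 0 < C ∧ ∀ r : ℝ, 0 < r →
          ∫⁻ x in cube n r, (ENNReal.ofReal |eval (fun i => x i) P|) ^ (-μ) ≤
            ENNReal.ofReal (C *
              (r ^ ((n : ℝ) - μ * ((∑ i, α i : ℝ) + 1) / (∑ i, α i : ℝ)) +
                r ^ ((n : ℝ) +
                  (1 - (2 : ℝ) ^ (l - 1)) / ((2 : ℝ) ^ (l - 1) + (∑ i, α i : ℝ)) -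
                  (((2 : ℝ) ^ (l - 1)) / ((2 : ℝ) ^ (l - 1) + (∑ i, α i : ℝ))) / μ))) := by
    intro μ hμ hμτ
    obtain ⟨C, hC, H⟩ := cube_bound P l hl1 hln α hα _ _ μ rfl rfl hμ hμτ
    obtain ⟨e1, e2⟩ := expo_ineq _ _ _ _ μ hM1 hk1' rfl rfl hμ hμτ
    refine ⟨C, hC, fun r hr => ?_⟩
    rw [cube_lintegral]
    refine (H r hr).trans (ENNReal.ofReal_le_ofReal ?_)
    refine mul_le_mul_of_nonneg_left (rpow_between r _ _ _ hr ?_ ?_) hC.le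
    · linarith
    · linarith
  refine ⟨main, fun t ht htτ => ?_⟩
  obtain ⟨C, hC, H⟩ := main t ht htτ
  refine ⟨cube n 1, ?_, (H 1 one_pos).trans_lt ENNReal.ofReal_lt_top⟩
  have ho : IsOpen (cube n 1) := by
    have : cube n 1 = ⋂ i, {x : EuclideanSpace ℝ (Fin n) | x i ∈ Set.Ioo (-1 : ℝ) 1} := by
      ext x; simp [cube]
    rw [this]
    refine isOpen_iInter_of_finite fun i => ?_
    have hc : Continuous fun x : EuclideanSpace ℝ (Fin n) => x i := by fun_prop
    exact isOpen_Ioo.preimage hc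
  exact ho.mem_nhds (fun i => by simp)
end
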